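/- arXiv:1610.04626 — 11 statements merged into one kernel-verified Lean document; each statement's English description precedes it below -/
import Mathlib

section
/- Let A, B, C be three affinely independent points in the Euclidean plane, and set a = dist(B,C), b = dist(C,A), c = dist(A,B). Let A' = (b/(b+c))·B + (c/(b+c))·C, B' = (a/(a+c))·A + (c/(a+c))·C, C' = (a/(a+b))·A + (b/(a+b))·B be the feet of the internal angle bisectors from A, B, C respectively. Then dist(B',C')² − dist(A',C')² = (a − b) · (a·b·c)/((a+b)(a+c)²(b+c)²) · q(a,b,c). -/
/-- The Sharygin cubic form `q(a,b,c)`. -/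
noncomputable def q (a b c : ℝ) : ℝ :=
  -c ^ 3 - c ^ 2 * (a + b) + c * (a ^ 2 + a * b + b ^ 2) +
    (a ^ 3 + a ^ 2 * b + a * b ^ 2 + b ^ 3)

/-- The squared norm of a displacement with barycentric coordinates `x, y, z` of sum zero. -/
lemma norm_sq_smul_add_smul_add_smul_of_add_eq_zero {V : Type*} [NormedAddCommGroup V]
    [InnerProductSpace ℝ V] (A B C : V) {x y z : ℝ} (h : x + y + z = 0) :
    ‖x • A + y • B + z • C‖ ^ 2 =
      -(dist B C ^ 2 * (y * z) + dist C A ^ 2 * (z * x) + dist A B ^ 2 * (x * y)) := by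
  obtain rfl : z = -x - y := by linarith
  simp only [dist_eq_norm, ← real_inner_self_eq_norm_sq, inner_add_left, inner_add_right,
    inner_sub_left, inner_sub_right, real_inner_smul_left, real_inner_smul_right,
    real_inner_comm A B, real_inner_comm A C, real_inner_comm B C]
  ring

/-- For a triangle `ABC` with side lengths `a = BC`, `b = CA`, `c = AB`, and the feet
`A', B', C'` of its internal angle bisectors, one has
`B'C'² − A'C'² = (a − b) · abc/((a+b)(a+c)²(b+c)²) · q(a,b,c)`. -/
theorem dist_sq_sub_dist_sq_bisectral (A B C : EuclideanSpace ℝ (Fin 2))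
    (hABC : AffineIndependent ℝ ![A, B, C])
    (a b c : ℝ) (ha : a = dist B C) (hb : b = dist C A) (hc : c = dist A B)
    (A' B' C' : EuclideanSpace ℝ (Fin 2))
    (hA' : A' = (b / (b + c)) • B + (c / (b + c)) • C)
    (hB' : B' = (a / (a + c)) • A + (c / (a + c)) • C)
    (hC' : C' = (a / (a + b)) • A + (b / (a + b)) • B) :
    dist B' C' ^ 2 - dist A' C' ^ 2 =
      (a - b) * (a * b * c) / ((a + b) * (a + c) ^ 2 * (b + c) ^ 2) * q a b c := by
  have hBC : B ≠ C := fun h => absurd (hABC.injective (a₁ := 1) (a₂ := 2) h) (by decide)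
  have hCA : C ≠ A := fun h => absurd (hABC.injective (a₁ := 2) (a₂ := 0) h) (by decide)
  have hAB : A ≠ B := fun h => absurd (hABC.injective (a₁ := 0) (a₂ := 1) h) (by decide)
  have ha₀ : 0 < a := ha ▸ dist_pos.mpr hBC
  have hb₀ : 0 < b := hb ▸ dist_pos.mpr hCA
  have hc₀ : 0 < c := hc ▸ dist_pos.mpr hAB
  have hab : a + b ≠ 0 := by positivity
  have hac : a + c ≠ 0 := by positivity
  have hbc : b + c ≠ 0 := by positivity
  have hB'C' : B' - C' =
      (a / (a + c) - a / (a + b)) • A + (-(b / (a + b))) • B + (c / (a + c)) • C := by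
    rw [hB', hC']
    module
  have hA'C' : A' - C' =
      (-(a / (a + b))) • A + (b / (b + c) - b / (a + b)) • B + (c / (b + c)) • C := by
    rw [hA', hC']
    module
  rw [dist_eq_norm, dist_eq_norm, hB'C', hA'C',
    norm_sq_smul_add_smul_add_smul_of_add_eq_zero A B C (by field_simp; ring),
    norm_sq_smul_add_smul_add_smul_of_add_eq_zero A B C (by field_simp; ring),
    ← ha, ← hb, ← hc, q]
  field_simp
  ring
end

section
/- Let A, B, C be three affinely independent points in the Euclidean plane with side lengths a = dist(B,C), b = dist(C,A), c = dist(A,B), and let A', B', C' be the feet of the internal angle bisectors from A, B, C respectively (so A' = (b/(b+c))·B + (c/(b+c))·C, etc.). Then dist(B',C') = dist(A',C') if and only if a = b or q(a,b,c) = 0. In particular, a scalene triangle has dist(B',C') = dist(A',C') in its bisectral triangle exactly when its side lengths satisfy q(a,b,c) = 0. -/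
/-- The squared length of a linear combination of two vectors, in terms of the lengths of the
vectors and of their difference. -/
lemma norm_smul_add_smul_sq {E : Type*} [NormedAddCommGroup E] [InnerProductSpace ℝ E]
    (u v : E) (x y : ℝ) :
    ‖x • u + y • v‖ ^ 2 =
      x ^ 2 * ‖u‖ ^ 2 + x * y * (‖u‖ ^ 2 + ‖v‖ ^ 2 - ‖u - v‖ ^ 2) + y ^ 2 * ‖v‖ ^ 2 := by
  rw [norm_add_sq_real, norm_sub_sq_real, norm_smul, norm_smul, mul_pow, mul_pow,
    Real.norm_eq_abs, Real.norm_eq_abs, sq_abs, sq_abs, real_inner_smul_left,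
    real_inner_smul_right]
  ring

/-- For a triangle `ABC` with side lengths `a = BC`, `b = CA`, `c = AB`, and the feet
`A', B', C'` of its internal angle bisectors, the bisectral triangle satisfies
`B'C' = A'C'` if and only if `a = b` or `q(a,b,c) = 0`. -/
theorem bisectral_isosceles_iff (A B C : EuclideanSpace ℝ (Fin 2))
    (hABC : AffineIndependent ℝ ![A, B, C])
    (a b c : ℝ) (ha : a = dist B C) (hb : b = dist C A) (hc : c = dist A B)
    (A' B' C' : EuclideanSpace ℝ (Fin 2))
    (hA' : A' = (b / (b + c)) • B + (c / (b + c)) • C)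
    (hB' : B' = (a / (a + c)) • A + (c / (a + c)) • C)
    (hC' : C' = (a / (a + b)) • A + (b / (a + b)) • B) :
    dist B' C' = dist A' C' ↔ a = b ∨ q a b c = 0 := by
  have hBC : B ≠ C := by simpa using hABC.injective.ne (show (1 : Fin 3) ≠ 2 by decide)
  have hCA : C ≠ A := by simpa using hABC.injective.ne (show (2 : Fin 3) ≠ 0 by decide)
  have hAB : A ≠ B := by simpa using hABC.injective.ne (show (0 : Fin 3) ≠ 1 by decide)
  have a_pos : 0 < a := ha ▸ dist_pos.mpr hBC
  have b_pos : 0 < b := hb ▸ dist_pos.mpr hCA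
  have c_pos : 0 < c := hc ▸ dist_pos.mpr hAB
  have hu : ‖A - C‖ = b := by rw [hb, dist_comm, dist_eq_norm]
  have hv : ‖B - C‖ = a := by rw [ha, dist_eq_norm]
  have huv : ‖(A - C) - (B - C)‖ = c := by rw [hc, dist_eq_norm, sub_sub_sub_cancel_right]
  have hBC' : B' - C' = (a / (a + c) - a / (a + b)) • (A - C) + (-(b / (a + b))) • (B - C) := by
    rw [hB', hC']
    match_scalars <;> field_simp
    ring
  have hAC' : A' - C' = (-(a / (a + b))) • (A - C) + (b / (b + c) - b / (a + b)) • (B - C) := by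
    rw [hA', hC']
    match_scalars <;> field_simp
    ring
  have key : dist B' C' ^ 2 - dist A' C' ^ 2 =
      a * b * c / ((a + b) * (a + c) ^ 2 * (b + c) ^ 2) * ((a - b) * q a b c) := by
    rw [dist_eq_norm, dist_eq_norm, hBC', hAC', norm_smul_add_smul_sq, norm_smul_add_smul_sq,
      hu, hv, huv, q]
    field_simp
    ring
  have coeff_ne : a * b * c / ((a + b) * (a + c) ^ 2 * (b + c) ^ 2) ≠ 0 := by positivity
  rw [← sq_eq_sq₀ dist_nonneg dist_nonneg, ← sub_eq_zero, key, mul_eq_zero_iff_left coeff_ne,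
    mul_eq_zero, sub_eq_zero]
end

section
/- The projective plane cubic curve defined by q(a,b,c) = 0 is smooth: if complex numbers a, b, c satisfy ∂q/∂a = ∂q/∂b = ∂q/∂c = 0 simultaneously, then a = b = c = 0. -/
open MvPolynomial

/-- The Sharygin cubic as a polynomial in three variables `a = X 0`, `b = X 1`, `c = X 2`. -/
noncomputable def qPoly : MvPolynomial (Fin 3) ℂ :=
  -(X 2) ^ 3 - (X 2) ^ 2 * (X 0 + X 1) + X 2 * ((X 0) ^ 2 + X 0 * X 1 + (X 1) ^ 2) +
    ((X 0) ^ 3 + (X 0) ^ 2 * X 1 + X 0 * (X 1) ^ 2 + (X 1) ^ 3)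

/-- The projective cubic `q = 0` is smooth: if all three formal partial derivatives of `q`
vanish simultaneously at `(a, b, c) ∈ ℂ³`, then `a = b = c = 0`. -/
theorem sharygin_cubic_smooth (a b c : ℂ)
    (h : ∀ i : Fin 3, eval ![a, b, c] (pderiv i qPoly) = 0) :
    a = 0 ∧ b = 0 ∧ c = 0 := by
  have ha := h 0
  have hb := h 1
  have hc := h 2
  simp [qPoly, pderiv_X] at ha hb hc
  have hfac : (a - b) * (c + 2 * a + 2 * b) = 0 := by linear_combination ha - hb
  rcases mul_eq_zero.mp hfac with hab | hab
  · obtain rfl : a = b := sub_eq_zero.mp hab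
    have hg : 13 * c * a + 15 * a ^ 2 = 0 := by linear_combination 3 * ha - hc
    have ha3 : a ^ 3 = 0 := by
      linear_combination (169 * a * ha + (13 * c - 54 * a) * hg) / 204
    obtain rfl : a = 0 := by simpa using ha3
    have hc2 : c ^ 2 = 0 := by linear_combination -ha
    exact ⟨rfl, rfl, by simpa using hc2⟩
  · obtain rfl : c = -2 * (a + b) := by linear_combination hab
    have hs2 : (a + b) ^ 2 = 0 := by linear_combination (ha + hb - 4 * hc) / 18
    have hs : a + b = 0 := by simpa using hs2
    obtain rfl : b = -a := by linear_combination hs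
    have ha2 : a ^ 2 = 0 := by linear_combination hc
    obtain rfl : a = 0 := by simpa using ha2
    simp
end

section
/- The polynomial 32 + 115·t + 506·t² + 1053·t³ + 1212·t⁴ + 1053·t⁵ + 506·t⁶ + 115·t⁷ + 32·t⁸ is irreducible over ℚ. -/
open Polynomial

namespace Polynomial

/-- A primitive polynomial is irreducible if its image under a ring homomorphism to a domain that
does not kill the leading coefficient is irreducible. -/
theorem IsPrimitive.irreducible_of_irreducible_map_of_leadingCoeff_ne_zero
    {R S : Type*} [CommRing R] [IsDomain R] [CommRing S] [IsDomain S] (φ : R →+* S) {f : R[X]}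
    (hf : f.IsPrimitive) (hlead : φ f.leadingCoeff ≠ 0) (hirr : Irreducible (f.map φ)) :
    Irreducible f := by
  have key : ∀ a, a ∣ f → IsUnit (a.map φ) → IsUnit a := by
    rintro a ⟨b, hab⟩ hunit
    have ha : φ a.leadingCoeff ≠ 0 := by
      rw [hab, leadingCoeff_mul, map_mul] at hlead
      exact left_ne_zero_of_mul hlead
    have hdeg : a.natDegree = 0 := by
      rw [← natDegree_map_of_leadingCoeff_ne_zero φ ha]
      exact natDegree_eq_zero_of_isUnit hunit
    have hprim : a.IsPrimitive := isPrimitive_of_dvd hf ⟨b, hab⟩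
    rw [eq_C_of_natDegree_eq_zero hdeg] at hprim ⊢
    exact isUnit_C.mpr (isPrimitive_iff_isUnit_of_C_dvd.mp hprim _ dvd_rfl)
  refine ⟨fun h => hirr.not_isUnit (h.map (mapRingHom φ)), fun a b h => ?_⟩
  exact (hirr.isUnit_or_isUnit (by rw [h, Polynomial.map_mul])).imp
    (key a ⟨b, h⟩) (key b ⟨a, by rw [h, mul_comm]⟩)

end Polynomial

/-- The polynomial `32 + 115t + 506t² + 1053t³ + 1212t⁴ + 1053t⁵ + 506t⁶ + 115t⁷ + 32t⁸`
over a commutative ring. -/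
noncomputable def inflexionPoly (R : Type*) [CommRing R] : R[X] :=
  C 32 + C 115 * X + C 506 * X ^ 2 + C 1053 * X ^ 3 + C 1212 * X ^ 4 +
    C 1053 * X ^ 5 + C 506 * X ^ 6 + C 115 * X ^ 7 + C 32 * X ^ 8

theorem inflexionPoly_map {R S : Type*} [CommRing R] [CommRing S] (φ : R →+* S) :
    (inflexionPoly R).map φ = inflexionPoly S := by
  simp [inflexionPoly, map_ofNat]

theorem inflexionPoly_natDegree {R : Type*} [CommRing R] (h : (32 : R) ≠ 0) :
    (inflexionPoly R).natDegree = 8 := by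
  unfold inflexionPoly
  compute_degree!

/-- In a nontrivial ring of characteristic five, a root of `inflexionPoly` is fixed neither by
the third nor by the fourth power of Frobenius. -/
theorem frobenius_ne_of_inflexionPoly_root {A : Type*} [CommRing A] [Nontrivial A]
    (h5 : (5 : A) = 0) {x : A}
    (hx : 32 + 115 * x + 506 * x ^ 2 + 1053 * x ^ 3 + 1212 * x ^ 4 + 1053 * x ^ 5 +
      506 * x ^ 6 + 115 * x ^ 7 + 32 * x ^ 8 = 0) :
    x ^ 125 ≠ x ∧ x ^ 625 ≠ x := by
  have hG : 1 - 2 * x ^ 2 - x ^ 3 + x ^ 4 - x ^ 5 - 2 * x ^ 6 + x ^ 8 = 0 := by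
    linear_combination 3 * hx + (-19 - 69 * x - 304 * x ^ 2 - 632 * x ^ 3 - 727 * x ^ 4 - 632 *
      x ^ 5 - 304 * x ^ 6 - 69 * x ^ 7 - 19 * x ^ 8) * h5
  have h25 : x ^ 25 = -2 - x + x ^ 2 + x ^ 3 + 2 * x ^ 4 - 2 * x ^ 5 - x ^ 6 - 2 * x ^ 7 := by
    linear_combination (2 + x - 2 * x ^ 2 - 2 * x ^ 3 - 2 * x ^ 4 + 2 * x ^ 5 + 2 * x ^ 6 + x ^
      7 - x ^ 10 + 2 * x ^ 11 - 2 * x ^ 13 + x ^ 14 + 2 * x ^ 15 + x ^ 17) * hG + (x ^ 2 + x ^ 3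
      - x ^ 4 - x ^ 5 + x ^ 7 - x ^ 9 + x ^ 11 + x ^ 12 + x ^ 13 - 2 * x ^ 15 + 2 * x ^ 17 - x ^
      19 + x ^ 20 + x ^ 21) * h5
  have h125 : x ^ 125 = 2 * x + 2 * x ^ 2 + 2 * x ^ 3 + x ^ 4 - 2 * x ^ 5 - 2 * x ^ 6 := by
    rw [show x ^ 125 = (x ^ 25) ^ 5 by ring, h25]
    linear_combination (-2 - 2 * x - x ^ 2 + 2 * x ^ 3 + 2 * x ^ 4 - x ^ 5 - 2 * x ^ 6 - 2 * x ^
      7 - 2 * x ^ 9 + 2 * x ^ 11 - 2 * x ^ 13 + 2 * x ^ 14 - 2 * x ^ 15 - x ^ 16 + x ^ 17 + 2 *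
      x ^ 18 - x ^ 19 + x ^ 21 - x ^ 22 - x ^ 23 - 2 * x ^ 24 + x ^ 25 - 2 * x ^ 27) * hG + (-6
      - 16 * x - x ^ 2 + 38 * x ^ 3 + 69 * x ^ 4 + 9 * x ^ 5 - 154 * x ^ 6 - 210 * x ^ 7 - 39 *
      x ^ 8 + 330 * x ^ 9 + 474 * x ^ 10 + 73 * x ^ 11 - 514 * x ^ 12 - 808 * x ^ 13 - 226 * x ^
      14 + 627 * x ^ 15 + 979 * x ^ 16 + 463 * x ^ 17 - 613 * x ^ 18 - 958 * x ^ 19 - 624 * x ^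
      20 + 325 * x ^ 21 + 757 * x ^ 22 + 526 * x ^ 23 - 11 * x ^ 24 - 493 * x ^ 25 - 336 * x ^
      26 - 158 * x ^ 27 + 186 * x ^ 28 + 132 * x ^ 29 + 111 * x ^ 30 - 33 * x ^ 31 - 40 * x ^ 32
      - 49 * x ^ 33 - 16 * x ^ 34 - 6 * x ^ 35) * h5
  have h625 : x ^ 625 = 2 * x + x ^ 2 - x ^ 3 + x ^ 4 + 2 * x ^ 5 - x ^ 7 := by
    rw [show x ^ 625 = (x ^ 125) ^ 5 by ring, h125]
    linear_combination (-2 * x - x ^ 2 + 2 * x ^ 3 + x ^ 6 - x ^ 7 + 2 * x ^ 8 + 2 * x ^ 11 - x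
      ^ 12 - x ^ 13 - 2 * x ^ 14 - 2 * x ^ 15 + x ^ 16 - 2 * x ^ 17 - x ^ 18 - 2 * x ^ 19 + x ^
      20 - 2 * x ^ 22) * hG + (-x ^ 3 - x ^ 4 + 7 * x ^ 5 + 32 * x ^ 6 + 95 * x ^ 7 + 208 * x ^
      8 + 321 * x ^ 9 + 327 * x ^ 10 + 112 * x ^ 11 - 352 * x ^ 12 - 863 * x ^ 13 - 1063 * x ^
      14 - 698 * x ^ 15 + 167 * x ^ 16 + 1042 * x ^ 17 + 1322 * x ^ 18 + 833 * x ^ 19 - 66 * x ^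
      20 - 755 * x ^ 21 - 809 * x ^ 22 - 368 * x ^ 23 + 102 * x ^ 24 + 297 * x ^ 25 + 209 * x ^
      26 + 32 * x ^ 27 - 49 * x ^ 28 - 32 * x ^ 29 - 6 * x ^ 30) * h5
  constructor <;> intro h <;> apply one_ne_zero (α := A)
  · rw [h125] at h
    linear_combination (1 + 2 * x - 2 * x ^ 2 + 2 * x ^ 4 - 2 * x ^ 5 - 2 * x ^ 6 + x ^ 7) * h +
      (1 - x - 2 * x ^ 2 - 2 * x ^ 4 + 2 * x ^ 5) * hG + (-x ^ 3 - x ^ 4 + x ^ 6 + x ^ 9 - x ^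
      11) * h5
  · rw [h625] at h
    linear_combination (-1 - x + x ^ 2 - x ^ 3 + 2 * x ^ 4 - 2 * x ^ 5 + x ^ 6 + 2 * x ^ 7) * h
      + (1 + x - x ^ 2 + 2 * x ^ 3 - 2 * x ^ 4 + x ^ 5 + 2 * x ^ 6) * hG + (x ^ 2 + x ^ 5) * h5

theorem inflexionPoly_zmod_five_irreducible : Irreducible (inflexionPoly (ZMod 5)) := by
  have : Fact (Nat.Prime 5) := ⟨by norm_num⟩
  have hdeg : (inflexionPoly (ZMod 5)).natDegree = 8 := inflexionPoly_natDegree (by decide)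
  have hne : inflexionPoly (ZMod 5) ≠ 0 :=
    ne_zero_of_natDegree_gt (n := 0) (by lia)
  have hunit : ¬ IsUnit (inflexionPoly (ZMod 5)) := fun h => by
    simpa [hdeg] using natDegree_eq_zero_of_isUnit h
  rw [irreducible_iff_lt_natDegree_lt hne hunit]
  intro q hq hqdeg hdvd
  rw [hdeg, Finset.mem_Ioc] at hqdeg
  obtain ⟨g, hg, hgq⟩ := exists_irreducible_of_natDegree_pos hqdeg.1
  have hgdeg : g.natDegree ≤ 4 := (natDegree_le_of_dvd hgq hq.ne_zero).trans hqdeg.2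
  have : Fact (Irreducible g) := ⟨hg⟩
  have h5 : (5 : AdjoinRoot g) = 0 := by
    have h : (5 : ZMod 5) = 0 := by reduce_mod_char
    have h' := congrArg (AdjoinRoot.of g) h
    rwa [map_ofNat, map_zero] at h'
  have hroot := AdjoinRoot.mk_eq_zero.mpr (hgq.trans hdvd)
  simp only [inflexionPoly, map_add, map_mul, map_pow, AdjoinRoot.mk_X, map_ofNat] at hroot
  obtain ⟨h125, h625⟩ := frobenius_ne_of_inflexionPoly_root h5 hroot
  have hfrob : ∀ n, g.natDegree ∣ n → AdjoinRoot.root g ^ 5 ^ n = AdjoinRoot.root g := by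
    intro n hn
    have h := AdjoinRoot.mk_eq_zero.mpr
      (hg.natDegree_dvd_iff_dvd_X_pow_card_pow_sub_X.mp hn)
    simpa [sub_eq_zero] using h
  have hpos := hg.natDegree_pos
  have hdvd_three_or_four : g.natDegree ∣ 3 ∨ g.natDegree ∣ 4 := by
    interval_cases g.natDegree <;> decide
  rcases hdvd_three_or_four with h | h
  · exact h125 (by simpa using hfrob 3 h)
  · exact h625 (by simpa using hfrob 4 h)

theorem inflexionPoly_int_isPrimitive : (inflexionPoly ℤ).IsPrimitive := by
  rw [isPrimitive_iff_isUnit_of_C_dvd]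
  intro r hr
  rw [C_dvd_iff_dvd_coeff] at hr
  have h0 : r ∣ 32 := by simpa [inflexionPoly, coeff_X, coeff_C] using hr 0
  have h1 : r ∣ 115 := by simpa [inflexionPoly, coeff_X, coeff_C, coeff_X_pow] using hr 1
  have h : r ∣ 18 * 32 - 5 * 115 := dvd_sub (h0.mul_left 18) (h1.mul_left 5)
  exact isUnit_of_dvd_one (by simpa using h)

theorem inflexionPoly_int_irreducible : Irreducible (inflexionPoly ℤ) := by
  have : Fact (Nat.Prime 5) := ⟨by norm_num⟩
  refine inflexionPoly_int_isPrimitive.irreducible_of_irreducible_map_of_leadingCoeff_ne_zero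
    (Int.castRingHom (ZMod 5)) ?_ ?_
  · rw [leadingCoeff, inflexionPoly_natDegree (by norm_num)]
    have h : (32 : ZMod 5) ≠ 0 :=
      mt (ZMod.natCast_eq_zero_iff 32 5).mp (by decide)
    simpa [inflexionPoly, coeff_X, coeff_X_pow] using h
  · rw [inflexionPoly_map]
    exact inflexionPoly_zmod_five_irreducible

/-- The polynomial `32 + 115t + 506t² + 1053t³ + 1212t⁴ + 1053t⁵ + 506t⁶ + 115t⁷ + 32t⁸`
is irreducible over `ℚ`. -/
theorem inflexion_field_poly_irreducible :
    Irreducible (C 32 + C 115 * X + C 506 * X ^ 2 + C 1053 * X ^ 3 + C 1212 * X ^ 4 +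
      C 1053 * X ^ 5 + C 506 * X ^ 6 + C 115 * X ^ 7 + C 32 * X ^ 8 : ℚ[X]) := by
  have h := (IsPrimitive.Int.irreducible_iff_irreducible_map_cast
    inflexionPoly_int_isPrimitive).mp inflexionPoly_int_irreducible
  rwa [inflexionPoly_map] at h
end

section
/- Let p and q be coprime integers with p odd. Then the greatest common divisor of (p² + 32q²)² and 4·p·q·(p² + 5pq − 32q²) divides 153. In particular this gcd lies in the set {1, 3, 9, 17, 51, 153}. -/
/-- If `p` is odd and coprime to `q`, then `p² + 32q²` is coprime to `2`, `p` and `q`. -/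
lemma isCoprime_sq_add_mul_sq {p q : ℤ} (hco : IsCoprime p q) (hodd : Odd p) :
    IsCoprime (p ^ 2 + 32 * q ^ 2) 2 ∧ IsCoprime (p ^ 2 + 32 * q ^ 2) p ∧
      IsCoprime (p ^ 2 + 32 * q ^ 2) q := by
  have hp2 : IsCoprime p 2 := Int.isCoprime_two_right.mpr hodd
  refine ⟨?_, ?_, ?_⟩
  · rw [show p ^ 2 + 32 * q ^ 2 = p ^ 2 + 2 * (16 * q ^ 2) by ring]
    exact hp2.pow_left.add_mul_left_left _
  · rw [show p ^ 2 + 32 * q ^ 2 = 2 ^ 5 * q ^ 2 + p * p by ring]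
    exact (hp2.symm.pow_left.mul_left hco.symm.pow_left).add_mul_left_left _
  · rw [show p ^ 2 + 32 * q ^ 2 = p ^ 2 + q * (32 * q) by ring]
    exact hco.pow_left.add_mul_left_left _

/-- A common divisor of the numerator and denominator of the duplication formula
divides `153`. -/
lemma dvd_of_dvd_duplication {p q d : ℤ} (hco : IsCoprime p q) (hodd : Odd p)
    (hnum : d ∣ (p ^ 2 + 32 * q ^ 2) ^ 2)
    (hden : d ∣ 4 * p * q * (p ^ 2 + 5 * p * q - 32 * q ^ 2)) : d ∣ 153 := by
  obtain ⟨h2, hp, hq⟩ := isCoprime_sq_add_mul_sq hco hodd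
  have hd2 : IsCoprime d 2 := h2.pow_left.of_isCoprime_of_dvd_left hnum
  have hdp : IsCoprime d p := hp.pow_left.of_isCoprime_of_dvd_left hnum
  have hdq : IsCoprime d q := hq.pow_left.of_isCoprime_of_dvd_left hnum
  have hd4 : IsCoprime d (4 * p * q) := by
    rw [show (4 : ℤ) = 2 ^ 2 by norm_num]
    exact (hd2.pow_right.mul_right hdp).mul_right hdq
  obtain ⟨k, hk⟩ := hd4.dvd_of_dvd_mul_left hden
  have hdu : IsCoprime d (32 * q - 5 * p) := by
    obtain ⟨a, b, hab⟩ : IsCoprime d (2 ^ 10 * q ^ 2) := hd2.pow_right.mul_right hdq.pow_right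
    exact ⟨a + 25 * b * k, b * (57 * q + 5 * p), by linear_combination hab - 25 * b * hk⟩
  have hmod : d ∣ q ^ 3 * (32 * q - 5 * p) * 153 := by
    obtain ⟨m, hm⟩ := hnum
    refine ⟨m - k * (p ^ 2 - 5 * p * q + 121 * q ^ 2), ?_⟩
    linear_combination hm - (p ^ 2 - 5 * p * q + 121 * q ^ 2) * hk
  exact (hdq.pow_right.mul_right hdu).dvd_of_dvd_mul_left hmod


/-- For coprime integers `p`, `q` with `p` odd, the gcd of `(p² + 32q²)²` and
`4pq(p² + 5pq − 32q²)` divides `153`; in particular it lies in `{1, 3, 9, 17, 51, 153}`. -/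
theorem gcd_duplication_divides (p q : ℤ) (hco : IsCoprime p q) (hodd : Odd p) :
    (Int.gcd ((p ^ 2 + 32 * q ^ 2) ^ 2) (4 * p * q * (p ^ 2 + 5 * p * q - 32 * q ^ 2)) : ℤ) ∣
        153 ∧
      Int.gcd ((p ^ 2 + 32 * q ^ 2) ^ 2) (4 * p * q * (p ^ 2 + 5 * p * q - 32 * q ^ 2)) ∈
        ({1, 3, 9, 17, 51, 153} : Set ℕ) := by
  have hdvd := dvd_of_dvd_duplication hco hodd (Int.gcd_dvd_left _ _) (Int.gcd_dvd_right _ _)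
  refine ⟨hdvd, ?_⟩
  have hmem := Nat.mem_divisors.mpr ⟨Int.natCast_dvd_natCast.mp hdvd, by norm_num⟩
  rw [show Nat.divisors 153 = {1, 3, 9, 17, 51, 153} by decide +kernel] at hmem
  simpa only [Finset.mem_insert, Finset.mem_singleton,
    Set.mem_insert_iff, Set.mem_singleton_iff] using hmem
end

section
/- The elliptic curve W over ℚ given by y² = x³ + 5x² − 32x has infinitely many rational points: the set of pairs (x, y) ∈ ℚ × ℚ with y² = x³ + 5x² − 32x is infinite. -/
/-- Points of `y² = x³ + 5x² − 32x` in the coordinates `x = (a / d)²`, `y = a b / d³`, with `d`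
divisible by any given power of `2`; the inductive step is duplication on the curve. -/
theorem exists_quartic_solution (n : ℕ) :
    ∃ a b d : ℤ, Odd a ∧ d ≠ 0 ∧ 2 ^ (n + 1) ∣ d ∧
      b ^ 2 = a ^ 4 + 5 * a ^ 2 * d ^ 2 - 32 * d ^ 4 := by
  induction n with
  | zero => exact ⟨11, 127, 4, by decide, by norm_num, by norm_num, by norm_num⟩
  | succ n ih =>
    obtain ⟨a, b, d, ha, hd, hdvd, h⟩ := ih
    have hd2 : Even d := even_iff_two_dvd.mpr ((dvd_pow_self 2 n.succ_ne_zero).trans hdvd)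
    have ha0 : a ≠ 0 := by rintro rfl; simp at ha
    have hb : Odd b := by
      have : Odd (b ^ 2) := by rw [h]; simp [parity_simps, ha, hd2]
      exact Int.odd_pow' two_ne_zero |>.mp this
    have hb0 : b ≠ 0 := by rintro rfl; simp at hb
    refine ⟨a ^ 4 + 32 * d ^ 4,
      a ^ 8 + 10 * a ^ 6 * d ^ 2 - 192 * a ^ 4 * d ^ 4 - 320 * a ^ 2 * d ^ 6 + 1024 * d ^ 8,
      2 * a * b * d, ?_, by simp [ha0, hb0, hd], ?_, ?_⟩
    · simp [parity_simps, ha, hd2]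
    · rw [pow_succ']
      exact (mul_dvd_mul_left 2 hdvd).trans ⟨a * b, by ring⟩
    · have h4 : b ^ 4 = (a ^ 4 + 5 * a ^ 2 * d ^ 2 - 32 * d ^ 4) ^ 2 := by rw [← h]; ring
      simp only [mul_pow]
      rw [h, h4]
      ring

theorem two_pow_dvd_den_of_odd {a d : ℤ} {n : ℕ} (ha : Odd a) (hd : d ≠ 0) (h : 2 ^ n ∣ d) :
    2 ^ n ∣ (((a : ℚ) / d) ^ 2).den := by
  set x : ℚ := ((a : ℚ) / d) ^ 2 with hx
  have hd' : (d : ℚ) ≠ 0 := by exact_mod_cast hd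
  have hxd : (x.den : ℚ) ≠ 0 := by exact_mod_cast x.den_nz
  have key : x.num * d ^ 2 = a ^ 2 * x.den := by
    have h1 : (x.num : ℚ) / x.den = a ^ 2 / d ^ 2 := by rw [Rat.num_div_den, hx, div_pow]
    rw [div_eq_div_iff hxd (pow_ne_zero 2 hd')] at h1
    exact_mod_cast h1
  have hcop : IsCoprime ((2 : ℤ) ^ n) (a ^ 2) :=
    (Int.isCoprime_two_left.mpr ha).pow
  have : (2 : ℤ) ^ n ∣ x.den :=
    hcop.dvd_of_dvd_mul_left (key ▸ (h.trans (dvd_pow_self d two_ne_zero)).mul_left _)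
  exact_mod_cast this

/-- The elliptic curve `y² = x³ + 5x² − 32x` has infinitely many rational points. -/
theorem infinitely_many_rational_points :
    {P : ℚ × ℚ | P.2 ^ 2 = P.1 ^ 3 + 5 * P.1 ^ 2 - 32 * P.1}.Infinite := by
  intro hfin
  obtain ⟨N, hN⟩ := (hfin.image fun P => P.1.den).bddAbove
  obtain ⟨a, b, d, ha, hd, hdvd, h⟩ := exists_quartic_solution N
  have hd' : (d : ℚ) ≠ 0 := by exact_mod_cast hd
  have hq : (b : ℚ) ^ 2 = a ^ 4 + 5 * a ^ 2 * d ^ 2 - 32 * d ^ 4 := by exact_mod_cast h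
  have hle : (((a : ℚ) / d) ^ 2).den ≤ N := by
    refine hN ⟨(((a : ℚ) / d) ^ 2, a * b / d ^ 3), ?_, rfl⟩
    simp only [Set.mem_ofPred_eq, div_pow, mul_pow, hq]
    field_simp
  have hpow := Nat.le_of_dvd (Rat.den_pos _) (two_pow_dvd_den_of_odd ha hd hdvd)
  have hlt : N + 1 < 2 ^ (N + 1) := Nat.lt_two_pow_self
  omega
end

section
/- The group of rational points of the elliptic curve W over ℚ given by y² = x³ + 5x² − 32x is isomorphic, as an abelian group, to ℤ ⊕ ℤ/2ℤ. In particular the rank of W over ℚ equals 1. -/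
/-- The elliptic curve `W : y² = x³ + 5x² − 32x` over `ℚ`. -/
def W : WeierstrassCurve ℚ := ⟨0, 5, 0, -32, 0⟩

section

open WeierstrassCurve.Affine

/-- A rational point `(x, y)` with `x ≠ 0` of `y² = x³ + a x² + b x` has `x = d m² / e²` in lowest
terms, where `d ∣ b` is squarefree and the associated quartic has a solution. -/
theorem exists_num_eq_mul_sq {a b : ℤ} {x y : ℚ} (hx : x ≠ 0)
    (h : y ^ 2 = x ^ 3 + a * x ^ 2 + b * x) :
    ∃ d m e N : ℤ, Squarefree d ∧ d ∣ b ∧ m ≠ 0 ∧ 0 < e ∧ IsCoprime (d * m ^ 2) e ∧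
      x.num = d * m ^ 2 ∧ (x.den : ℤ) = e ^ 2 ∧
      d * N ^ 2 = d ^ 2 * m ^ 4 + a * d * m ^ 2 * e ^ 2 + b * e ^ 4 := by
  obtain ⟨p, hp⟩ : ∃ p, p = x.num := ⟨_, rfl⟩
  obtain ⟨q, hq⟩ : ∃ q : ℤ, q = x.den := ⟨_, rfl⟩
  have hq0 : 0 < q := by rw [hq]; exact_mod_cast x.den_pos
  have hp0 : p ≠ 0 := by rw [hp]; exact Rat.num_ne_zero.mpr hx
  have hpq : IsCoprime p q := by
    rw [hp, hq]; exact Int.isCoprime_iff_nat_coprime.mpr (by simpa using x.reduced)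
  have hxpq : x = p / q := by rw [hp, hq]; exact_mod_cast (Rat.num_div_den x).symm
  have hqQ : (q : ℚ) ≠ 0 := by exact_mod_cast hq0.ne'
  have hsq : IsSquare (((q * (p * (p ^ 2 + a * p * q + b * q ^ 2)) : ℤ)) : ℚ) := by
    refine ⟨y * q ^ 2, ?_⟩
    have : y * q ^ 2 * (y * q ^ 2) = y ^ 2 * q ^ 4 := by ring
    rw [this, h, hxpq]
    push_cast
    field_simp
  obtain ⟨n, hn⟩ := Rat.isSquare_intCast_iff.mp hsq
  rw [← sq] at hn
  have hcop : IsCoprime q (p * (p ^ 2 + a * p * q + b * q ^ 2)) := by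
    refine IsCoprime.mul_right hpq.symm ?_
    have : IsCoprime q (p ^ 2) := hpq.symm.pow_right
    have h' := this.add_mul_left_right (a * p + b * q)
    rwa [show p ^ 2 + q * (a * p + b * q) = p ^ 2 + a * p * q + b * q ^ 2 by ring] at h'
  obtain ⟨e, he⟩ := Int.sq_of_isCoprime hcop hn
  obtain ⟨f, hf⟩ := Int.sq_of_isCoprime hcop.symm (by rw [mul_comm]; exact hn)
  replace he : q = e ^ 2 := he.resolve_right fun h => by nlinarith [sq_nonneg e]
  have he0 : e ≠ 0 := by rintro rfl; simp [he] at hq0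
  replace hf : p * (p ^ 2 + a * p * q + b * q ^ 2) = f ^ 2 := hf.elim id fun h => by
    have : f ^ 2 = 0 := by
      refine le_antisymm ?_ (sq_nonneg f)
      by_contra! hlt
      rw [h] at hn
      nlinarith [sq_nonneg n]
    rw [h, this, neg_zero]
  obtain ⟨d, m, hd, hdm⟩ : ∃ d m : ℤ, Squarefree d ∧ p = d * m ^ 2 := by
    obtain ⟨a', b', h1, h2⟩ := Nat.sq_mul_squarefree p.natAbs
    refine ⟨p.sign * a', b', ?_, ?_⟩
    · rw [← Int.squarefree_natAbs, Int.natAbs_mul, Int.natAbs_sign_of_ne_zero hp0]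
      simpa using h2
    · rw [mul_assoc, mul_comm (a' : ℤ), ← Nat.cast_pow, ← Nat.cast_mul, h1,
        Int.sign_mul_natAbs]
  have hm0 : m ≠ 0 := by rintro rfl; simp at hdm; exact hp0 hdm
  have hd0 : d ≠ 0 := hd.ne_zero
  obtain ⟨g, rfl⟩ : m ∣ f := by
    rw [← Int.pow_dvd_pow_iff two_ne_zero, ← hf]
    exact ⟨d * (p ^ 2 + a * p * q + b * q ^ 2), by rw [hdm]; ring⟩
  have hg : d * (p ^ 2 + a * p * q + b * q ^ 2) = g ^ 2 := by
    apply mul_left_cancel₀ (pow_ne_zero 2 hm0)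
    rw [← mul_pow, ← hf, ← mul_assoc, mul_comm (m ^ 2) d, ← hdm]
  obtain ⟨k, rfl⟩ : d ∣ g := (hd.dvd_pow_iff_dvd two_ne_zero).mp ⟨_, hg.symm⟩
  have hk : d * k ^ 2 = p ^ 2 + a * p * q + b * q ^ 2 := by
    apply mul_left_cancel₀ hd0
    rw [hg]; ring
  have hcop' : IsCoprime d q := by
    rw [hdm] at hpq; exact hpq.of_mul_left_left
  have hdb : d ∣ b := by
    refine (hcop'.pow_right (n := 2)).dvd_of_dvd_mul_right ?_
    refine ⟨k ^ 2 - d * m ^ 4 - a * m ^ 2 * q, ?_⟩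
    rw [mul_sub, mul_sub, hk, hdm]; ring
  refine ⟨d, m, |e|, k, hd, hdb, hm0, abs_pos.mpr he0, ?_, by rw [← hp, hdm], by simp [← hq, he],
    ?_⟩
  · rw [← hdm]
    refine IsCoprime.of_isCoprime_of_dvd_right hpq ?_
    rw [he, abs_dvd]; exact dvd_pow_self e two_ne_zero
  · rw [hk, hdm, he, sq_abs, (by decide : Even 4).pow_abs]
    ring

theorem eq_num_div_den_of {x : ℚ} {d m e : ℤ} (h₁ : x.num = d * m ^ 2)
    (h₂ : (x.den : ℤ) = e ^ 2) : x = d * m ^ 2 / e ^ 2 := by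
  conv_lhs => rw [← Rat.num_div_den x, h₁, ← Int.cast_natCast x.den, h₂]
  push_cast; rfl

theorem eq_of_squarefree_of_dvd {d : ℤ} (hd : Squarefree d) (hdb : d ∣ -32) :
    d = 1 ∨ d = -1 ∨ d = 2 ∨ d = -2 := by
  have : d ∣ 2 := by
    refine (hd.dvd_pow_iff_dvd (n := 5) (by norm_num)).mp ?_
    rw [← dvd_neg]; exact hdb
  have h3 := Int.le_of_dvd (by norm_num) this
  have h4 := Int.le_of_dvd (by norm_num) (neg_dvd.mpr this)
  have h5 : -2 ≤ d := by linarith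
  have h0 := hd.ne_zero
  interval_cases d <;> simp_all

/-- The square class of `x` on `W`. -/
theorem squareclass_W {x y : ℚ} (hx : x ≠ 0) (h : y ^ 2 = x ^ 3 + 5 * x ^ 2 - 32 * x) :
    ∃ r : ℚ, r ≠ 0 ∧ (x = r ^ 2 ∨ x = - r ^ 2 ∨ x = 2 * r ^ 2 ∨ x = -2 * r ^ 2) := by
  obtain ⟨d, m, e, N, hd, hdb, hm, he, -, h1, h2, -⟩ :=
    exists_num_eq_mul_sq (a := 5) (b := -32) hx (by rw [h]; push_cast; ring)
  refine ⟨m / e, by simp [hm, he.ne'], ?_⟩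
  have := eq_num_div_den_of h1 h2
  have hd' := eq_of_squarefree_of_dvd hd hdb
  rw [div_pow, this]
  rcases hd' with rfl | rfl | rfl | rfl
  all_goals simp [neg_div, mul_div_assoc]

/-- The square class of points on the 2-isogenous curve. -/
theorem squareclass_isog {x y : ℚ} (hx : 0 < x) (h : y ^ 2 = x ^ 3 - 10 * x ^ 2 + 153 * x) :
    ∃ r : ℚ, r ≠ 0 ∧ (x = r ^ 2 ∨ x = 17 * r ^ 2) := by
  obtain ⟨d, m, e, N, hd, hdb, hm, he, hc, h1, h2, hN⟩ :=
    exists_num_eq_mul_sq (a := -10) (b := 153) hx.ne' (by rw [h]; push_cast; ring)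
  refine ⟨m / e, by simp [hm, he.ne'], ?_⟩
  have hx' := eq_num_div_den_of h1 h2
  have hd0 : 0 < d := by
    have : 0 < d * m ^ 2 := by rw [← h1]; exact Rat.num_pos.mpr hx
    exact pos_of_mul_pos_left this (sq_nonneg m)
  have hd51 : d ∣ 51 := by
    refine (hd.dvd_pow_iff_dvd (n := 2) (by norm_num)).mp ?_
    exact hdb.trans ⟨17, by norm_num⟩
  have hd' : d = 1 ∨ d = 3 ∨ d = 17 ∨ d = 51 := by
    have h3 := Int.le_of_dvd (by norm_num) hd51
    interval_cases d <;> revert hd51 <;> decide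
  have key : ∀ c k : ℤ, d = 3 * c → 3 * k * d = 153 → ¬ (3 : ℤ) ∣ k → False := by
    rintro c k rfl hk hk3
    have hN' : N ^ 2 = 3 * c * m ^ 4 - 10 * m ^ 2 * e ^ 2 + 3 * k * e ^ 4 := by
      apply mul_left_cancel₀ hd.ne_zero
      rw [hN, ← hk]; ring
    have he3 : ¬ (3 : ℤ) ∣ e := fun h => by
      have := hc.isUnit_of_dvd' (Dvd.intro (c * m ^ 2) (by ring)) h
      exact absurd (Int.isUnit_iff.mp this) (by norm_num)
    have h3 : Prime (3 : ℤ) := Int.prime_three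
    have hmod : ∀ u v : ZMod 3, u ^ 2 + v ^ 2 = 0 → u = 0 ∧ v = 0 := by decide
    obtain ⟨hN3, hm3⟩ := hmod N (m * e : ℤ) (by
      have : ((N ^ 2 + (m * e) ^ 2 : ℤ) : ZMod 3) = 0 := by
        rw [hN']
        exact (ZMod.intCast_zmod_eq_zero_iff_dvd _ 3).mpr
          ⟨c * m ^ 4 - 3 * m ^ 2 * e ^ 2 + k * e ^ 4, by push_cast; ring⟩
      exact_mod_cast this)
    obtain ⟨n, rfl⟩ := (ZMod.intCast_zmod_eq_zero_iff_dvd _ 3).mp hN3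
    obtain ⟨l, rfl⟩ :=
      (h3.dvd_or_dvd ((ZMod.intCast_zmod_eq_zero_iff_dvd _ 3).mp hm3)).resolve_right he3
    have : (3 : ℤ) ∣ k * e ^ 4 :=
      ⟨n ^ 2 - 27 * c * l ^ 4 + 10 * l ^ 2 * e ^ 2, by push_cast at hN'; linarith⟩
    rcases h3.dvd_or_dvd this with h | h
    · exact hk3 h
    · exact he3 (h3.dvd_of_dvd_pow h)
  rw [div_pow, ← mul_div_assoc, hx']
  rcases hd' with rfl | rfl | rfl | rfl
  · simp
  · exact (key 1 17 (by norm_num) (by norm_num) (by norm_num)).elim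
  · simp
  · exact (key 17 1 (by norm_num) (by norm_num) (by norm_num)).elim

/-- A point of `W` whose `x`-coordinate is a nonzero square is, up to sign, the double of a
rational point. -/
theorem exists_half {r y : ℚ} (hr : r ≠ 0)
    (h : y ^ 2 = (r ^ 2) ^ 3 + 5 * (r ^ 2) ^ 2 - 32 * r ^ 2) :
    ∃ u v : ℚ, v ≠ 0 ∧ v ^ 2 = u ^ 3 + 5 * u ^ 2 - 32 * u ∧
      (u ^ 2 + 32) ^ 2 / (4 * v ^ 2) = r ^ 2 := by
  obtain ⟨s, hs⟩ : ∃ s : ℚ, s ^ 2 = r ^ 4 + 5 * r ^ 2 - 32 :=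
    ⟨y / r, by rw [div_pow, h]; field_simp⟩
  obtain ⟨w, t, hw, ht⟩ : ∃ w t : ℚ, w ^ 2 = 2 * r ^ 2 + 5 + 2 * t ∧
      t ^ 2 = r ^ 4 + 5 * r ^ 2 - 32 := by
    have hprod : (2 * r ^ 2 + 5 + 2 * s) * (2 * r ^ 2 + 5 - 2 * s) = 153 := by
      linear_combination -4 * hs
    have hpos : 0 < 2 * r ^ 2 + 5 + 2 * s := by
      by_contra! hneg
      nlinarith [sq_nonneg r]
    obtain ⟨w, hw0, hw | hw⟩ := squareclass_isog (y := 2 * r * (2 * r ^ 2 + 5 + 2 * s)) hpos (by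
      linear_combination -4 * (2 * r ^ 2 + 5 + 2 * s) * hs)
    · exact ⟨w, s, hw.symm, hs⟩
    · refine ⟨3 / w, -s, ?_, by rw [neg_sq, hs]⟩
      rw [hw] at hprod
      field_simp
      linear_combination -hprod / 17
  have hq : (w ^ 2 - 5) ^ 2 + 128 = 4 * r ^ 2 * w ^ 2 := by
    rw [hw]; linear_combination 4 * ht
  obtain ⟨u, hu⟩ : ∃ u : ℚ, u = (w ^ 2 - 5 + 2 * r * w) / 2 := ⟨_, rfl⟩
  have hu2 : u * (u - (w ^ 2 - 5)) = 32 := by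
    rw [hu]; linear_combination -hq / 4
  have hu0 : u ≠ 0 := by rintro rfl; norm_num at hu2
  have hw0 : w ≠ 0 := by rintro rfl; norm_num at hq
  refine ⟨u, w * u, mul_ne_zero hw0 hu0, by linear_combination -u * hu2, ?_⟩
  have : u ^ 2 + 32 = 2 * r * w * u := by
    rw [← hu2, hu]; ring
  rw [this]
  field_simp
  ring

/-- The naive multiplicative height of a rational number. -/
def ratHeight (x : ℚ) : ℕ := max x.num.natAbs x.den

theorem ratHeight_pos (x : ℚ) : 0 < ratHeight x := lt_max_of_lt_right x.den_pos

theorem ratHeight_div_le {a b : ℤ} {n : ℕ} (hb : b ≠ 0) (ha : |a| ≤ n) (hbn : |b| ≤ n) :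
    ratHeight ((a : ℚ) / b) ≤ n := by
  have h₁ : ((a : ℚ) / b).num ∣ a := by
    rw [← Rat.divInt_eq_div]; exact Rat.num_dvd a hb
  have h₂ : (((a : ℚ) / b).den : ℤ) ∣ b := by
    rw [← Rat.divInt_eq_div]; exact Rat.den_dvd a b
  rw [Int.abs_eq_natAbs] at ha hbn
  refine max_le ?_ ?_
  · rcases eq_or_ne a 0 with rfl | ha0
    · simp
    · have := Nat.le_of_dvd (Int.natAbs_pos.mpr ha0) (Int.natAbs_dvd_natAbs.mpr h₁)
      omega
  · have := Nat.le_of_dvd (Int.natAbs_pos.mpr hb) (Int.natCast_dvd.mp h₂)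
    omega

theorem exists_eq_div_of_ratHeight (x : ℚ) : ∃ p q : ℤ, 0 < q ∧ IsCoprime p q ∧ x = p / q ∧
    |p| ≤ ratHeight x ∧ q ≤ ratHeight x ∧ (ratHeight x : ℤ) ^ 2 ≤ p ^ 2 + q ^ 2 := by
  refine ⟨x.num, x.den, by exact_mod_cast x.den_pos,
    Int.isCoprime_iff_nat_coprime.mpr (by simpa using x.reduced),
    by exact_mod_cast (Rat.num_div_den x).symm, ?_, ?_, ?_⟩
  · rw [Int.abs_eq_natAbs]; exact_mod_cast le_max_left _ _
  · exact_mod_cast le_max_right _ _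
  · rw [ratHeight]
    rcases max_cases x.num.natAbs x.den with ⟨h, -⟩ | ⟨h, -⟩ <;> rw [h]
    · rw [Int.natAbs_sq]; nlinarith
    · nlinarith

/-- Duplication on the minimal model of `W` multiplies the logarithmic height by at least `4`,
up to the logarithm of the discriminant `612`. -/
theorem ratHeight_pow_four_le {x : ℚ} (hx : x * (4 * x ^ 2 + 5 * x - 8) ≠ 0) :
    ratHeight x ^ 4 ≤ 612 * ratHeight ((x ^ 2 + 2) ^ 2 / (x * (4 * x ^ 2 + 5 * x - 8))) := by
  obtain ⟨p, q, hq, hpq, rfl, -, -, hH⟩ := exists_eq_div_of_ratHeight x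
  obtain ⟨a, b, hb, hab, hx', ha, -, -⟩ := exists_eq_div_of_ratHeight
    (((p / q : ℚ) ^ 2 + 2) ^ 2 / ((p / q : ℚ) * (4 * (p / q : ℚ) ^ 2 + 5 * (p / q : ℚ) - 8)))
  set H := ratHeight (p / q : ℚ)
  set H' := ratHeight
    (((p / q : ℚ) ^ 2 + 2) ^ 2 / ((p / q : ℚ) * (4 * (p / q : ℚ) ^ 2 + 5 * (p / q : ℚ) - 8)))
  have hqQ : (q : ℚ) ≠ 0 := by exact_mod_cast hq.ne'
  have hbQ : (b : ℚ) ≠ 0 := by exact_mod_cast hb.ne'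
  obtain ⟨F, hF⟩ : ∃ F, F = (p ^ 2 + 2 * q ^ 2) ^ 2 := ⟨_, rfl⟩
  obtain ⟨G, hG⟩ : ∃ G, G = q * (p * (4 * p ^ 2 + 5 * p * q - 8 * q ^ 2)) := ⟨_, rfl⟩
  have hcross : F * b = a * G := by
    rw [div_eq_div_iff hx hbQ] at hx'
    field_simp at hx'
    rw [hF, hG]
    have : ((p ^ 2 + 2 * q ^ 2) ^ 2 * b : ℚ) =
        a * (q * (p * (4 * p ^ 2 + 5 * p * q - 8 * q ^ 2))) := by
      linear_combination hx'
    exact_mod_cast this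
  have hbez : F * (-48 * p ^ 2 - 40 * p * q + 153 * q ^ 2) * q +
      G * (12 * p ^ 3 - 5 * p ^ 2 * q + 40 * p * q ^ 2 - 20 * q ^ 3) = 612 * q ^ 7 := by
    rw [hF, hG]; ring
  have hFa : F ∣ 612 * a := by
    have h1 : F ∣ 612 * a * q ^ 7 := by
      refine ⟨a * (-48 * p ^ 2 - 40 * p * q + 153 * q ^ 2) * q +
        b * (12 * p ^ 3 - 5 * p ^ 2 * q + 40 * p * q ^ 2 - 20 * q ^ 3), ?_⟩
      linear_combination -a * hbez +
        (12 * p ^ 3 - 5 * p ^ 2 * q + 40 * p * q ^ 2 - 20 * q ^ 3) * -hcross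
    refine IsCoprime.dvd_of_dvd_mul_right ?_ h1
    rw [hF]
    refine IsCoprime.pow ?_
    have := (hpq.pow_left (m := 2)).add_mul_left_left (2 * q)
    rwa [show p ^ 2 + q * (2 * q) = p ^ 2 + 2 * q ^ 2 by ring] at this
  have hFpos : 0 < F := by rw [hF]; positivity
  have ha0 : a ≠ 0 := by
    rintro rfl
    rw [zero_mul] at hcross
    exact (mul_pos hFpos hb).ne' hcross
  have hle : F ≤ |612 * a| := Int.le_of_dvd (by positivity) ((dvd_abs _ _).mpr hFa)
  rw [abs_mul, abs_of_pos (by norm_num : (0 : ℤ) < 612)] at hle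
  have : (H : ℤ) ^ 4 ≤ 612 * H' := by
    have : ((H : ℤ) ^ 2) ^ 2 ≤ F := by
      rw [hF]
      exact pow_le_pow_left₀ (by positivity) (by nlinarith) 2
    nlinarith
  exact_mod_cast this

/-- Bounds for the height of `Q + P` and `Q + P + T` on the minimal model of `W`, for `P` and `T`
the points with coordinates `x = -1` and `x = 0`. -/
theorem ratHeight_translate_le {x z : ℚ} (hx : x ≠ -1) (h : z ^ 2 = x * (4 * x ^ 2 + 5 * x - 8)) :
    ratHeight ((-2 * x ^ 2 - 7 * x + 4 - 3 * z) / (2 * (x + 1) ^ 2)) ≤ 26 * ratHeight x ^ 2 ∧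
    ratHeight (-2 / ((-2 * x ^ 2 - 7 * x + 4 - 3 * z) / (2 * (x + 1) ^ 2))) ≤
      26 * ratHeight x ^ 2 := by
  obtain ⟨p, q, hq, hpq, hxpq, hp, hqH, -⟩ := exists_eq_div_of_ratHeight x
  have hHpos := ratHeight_pos x
  set H := ratHeight x
  have hqQ : (q : ℚ) ≠ 0 := by exact_mod_cast hq.ne'
  obtain ⟨n, hn⟩ : ∃ n : ℤ, (n : ℚ) = q ^ 2 * z := by
    have hsq : IsSquare (((q * (p * (4 * p ^ 2 + 5 * p * q - 8 * q ^ 2)) : ℤ)) : ℚ) := by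
      refine ⟨q ^ 2 * z, ?_⟩
      have : q ^ 2 * z * (q ^ 2 * z) = q ^ 4 * z ^ 2 := by ring
      rw [this, h, hxpq]
      push_cast
      field_simp
    obtain ⟨n, hn⟩ := Rat.isSquare_intCast_iff.mp hsq
    have : (n : ℚ) ^ 2 = (q ^ 2 * z) ^ 2 := by
      rw [mul_pow, h, hxpq]
      have : (n : ℚ) ^ 2 = ((q * (p * (4 * p ^ 2 + 5 * p * q - 8 * q ^ 2)) : ℤ)) := by
        rw [hn]; push_cast; ring
      rw [this]
      push_cast
      field_simp
    rcases sq_eq_sq_iff_eq_or_eq_neg.mp this with h | h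
    · exact ⟨n, h⟩
    · exact ⟨-n, by rw [Int.cast_neg, h, neg_neg]⟩
  have hn2 : n ^ 2 = q * (p * (4 * p ^ 2 + 5 * p * q - 8 * q ^ 2)) := by
    have : (n : ℚ) ^ 2 = q * (p * (4 * p ^ 2 + 5 * p * q - 8 * q ^ 2)) := by
      rw [hn, mul_pow, h, hxpq]; field_simp
    exact_mod_cast this
  have hpq1 : p + q ≠ 0 := by
    intro h0
    apply hx
    rw [hxpq, div_eq_iff hqQ]
    have : (p : ℚ) + q = 0 := by exact_mod_cast h0
    linarith
  obtain ⟨A, hA⟩ : ∃ A, A = -2 * p ^ 2 - 7 * p * q + 4 * q ^ 2 - 3 * n := ⟨_, rfl⟩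
  obtain ⟨B, hB⟩ : ∃ B, B = 2 * (p + q) ^ 2 := ⟨_, rfl⟩
  have hB0 : B ≠ 0 := by rw [hB]; positivity
  have hX : (-2 * x ^ 2 - 7 * x + 4 - 3 * z) / (2 * (x + 1) ^ 2) = (A : ℚ) / B := by
    have h1 : (A : ℚ) = q ^ 2 * (-2 * x ^ 2 - 7 * x + 4 - 3 * z) := by
      rw [hA]; push_cast; rw [hn, hxpq]; field_simp
    have h2 : (B : ℚ) = q ^ 2 * (2 * (x + 1) ^ 2) := by
      rw [hB]; push_cast; rw [hxpq]; field_simp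
    rw [h1, h2, mul_div_mul_left _ _ (pow_ne_zero 2 hqQ)]
  have hpa := abs_le.mp hp
  have hHpos' : (0 : ℤ) < H := by exact_mod_cast hHpos
  obtain ⟨K, hK⟩ : ∃ K : ℤ, K = H := ⟨_, rfl⟩
  rw [← hK] at hpa hqH hHpos'
  have hp2 : p ^ 2 ≤ K ^ 2 := sq_le_sq' hpa.1 hpa.2
  have hq2 : q ^ 2 ≤ K ^ 2 := pow_le_pow_left₀ hq.le hqH 2
  have hpq2 : |p * q| ≤ K ^ 2 := by
    rw [abs_le]; constructor <;> nlinarith [sq_nonneg (p - q), sq_nonneg (p + q)]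
  have hpq3 := abs_le.mp hpq2
  have hn3 : |3 * n| ≤ 13 * K ^ 2 := by
    refine abs_le_of_sq_le_sq ?_ (by positivity)
    have h1 : 4 * p ^ 2 + 5 * (p * q) - 8 * q ^ 2 ≤ 17 * K ^ 2 := by nlinarith [sq_nonneg q]
    have h2 : -(17 * K ^ 2) ≤ 4 * p ^ 2 + 5 * (p * q) - 8 * q ^ 2 := by nlinarith [sq_nonneg p]
    have h3 : |p * q| * |4 * p ^ 2 + 5 * (p * q) - 8 * q ^ 2| ≤ K ^ 2 * (17 * K ^ 2) :=
      mul_le_mul hpq2 (abs_le.mpr ⟨h2, h1⟩) (abs_nonneg _) (by positivity)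
    rw [← abs_mul] at h3
    have h4 := (le_abs_self _).trans h3
    nlinarith [sq_nonneg (K ^ 2)]
  have hn4 := abs_le.mp hn3
  have hAle : |A| ≤ 26 * K ^ 2 := by
    rw [abs_le, hA]; constructor <;> nlinarith [sq_nonneg p, sq_nonneg q]
  have hBle : |2 * B| ≤ 26 * K ^ 2 := by
    rw [abs_of_nonneg (by rw [hB]; positivity), hB]; nlinarith
  rw [hK] at hAle hBle
  rw [hX]
  constructor
  · refine ratHeight_div_le hB0 (by exact_mod_cast hAle) ?_
    rw [abs_mul, abs_two] at hBle
    push_cast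
    linarith [abs_nonneg B]
  · rcases eq_or_ne A 0 with hA0 | hA0
    · rw [hA0]
      simp only [Int.cast_zero, zero_div, div_zero]
      exact Nat.one_le_iff_ne_zero.mpr (by positivity)
    · have : (-2 : ℚ) / (A / B) = ((-(2 * B) : ℤ) : ℚ) / A := by
        push_cast; field_simp
      rw [this]
      exact ratHeight_div_le hA0 (by rw [abs_neg]; exact_mod_cast hBle) (by exact_mod_cast hAle)

theorem ratHeight_neg_two_div_le {x : ℚ} (hx : x ≠ 0) :
    ratHeight (-2 / x) ≤ 26 * ratHeight x ^ 2 := by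
  obtain ⟨p, q, hq, hpq, hxpq, hp, hqH, -⟩ := exists_eq_div_of_ratHeight x
  have hHpos := ratHeight_pos x
  have hp0 : p ≠ 0 := by rintro rfl; simp at hxpq; exact hx hxpq
  have : -2 / x = ((-(2 * q) : ℤ) : ℚ) / p := by
    rw [hxpq]; push_cast; field_simp
  rw [this]
  have : 1 ≤ (ratHeight x : ℤ) := by exact_mod_cast hHpos
  apply ratHeight_div_le hp0
  · rw [abs_neg, abs_of_pos (by positivity)]; push_cast; nlinarith
  · push_cast; nlinarith

/-- The nonzero `x`-coordinates of small height on `W`, as pairs of numerator and denominator. -/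
def smallFractions : List (ℤ × ℤ) :=
  [(-4, 1), (8, 1), (4, 1), (-8, 1), (-1, 1), (32, 1), (36, 1), (-8, 9), (-196, 25), (200, 49),
    (121, 16), (-512, 121)]

/-- Small solutions of the quartics attached to the square classes of `W`. -/
theorem exists_div_mem_of_quartic :
    ∀ d ∈ [(1 : ℤ), -1, 2, -2], ∀ m : ℕ, m < 23 → ∀ e : ℕ, e < 12 → m ≠ 0 → e ≠ 0 →
      IsSquare (d * (m : ℤ) ^ 4 + 5 * (m : ℤ) ^ 2 * (e : ℤ) ^ 2 - 32 / d * (e : ℤ) ^ 4) →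
      ∃ c ∈ smallFractions, d * (m : ℤ) ^ 2 * c.2 = c.1 * (e : ℤ) ^ 2 := by
  decide +kernel

/-- The points of `W` of small height. -/
theorem exists_div_of_ratHeight_le {x y : ℚ} (hx : x ≠ 0)
    (h : y ^ 2 = x ^ 3 + 5 * x ^ 2 - 32 * x) (hH : ratHeight (x / 4) ≤ 126) :
    ∃ c ∈ smallFractions, x = c.1 / c.2 := by
  obtain ⟨d, m, e, N, hd, hdb, hm, he, -, h1, h2, hN⟩ :=
    exists_num_eq_mul_sq (a := 5) (b := -32) hx (by rw [h]; push_cast; ring)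
  obtain ⟨p, q, hq, -, hxpq, hp, hqH, -⟩ := exists_eq_div_of_ratHeight (x / 4)
  have hd' := eq_of_squarefree_of_dvd hd hdb
  have hx' : x = (4 * p : ℤ) / (q : ℤ) := by push_cast; linear_combination 4 * hxpq
  have hnum : d * m ^ 2 ∣ 4 * p := by
    rw [← h1, hx', ← Rat.divInt_eq_div]; exact Rat.num_dvd _ hq.ne'
  have hden : e ^ 2 ∣ q := by
    rw [← h2, hx', ← Rat.divInt_eq_div]; exact Rat.den_dvd _ _
  have hp0 : p ≠ 0 := by rintro rfl; simp at hx'; exact hx hx'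
  have hH' : (ratHeight (x / 4) : ℤ) ≤ 126 := by exact_mod_cast hH
  have he12 : e < 12 := by
    have := Int.le_of_dvd hq hden
    nlinarith
  have hm23 : |m| < 23 := by
    have h3 : m ^ 2 ∣ |4 * p| := (dvd_abs _ _).mpr ((Dvd.intro_left d rfl).trans hnum)
    have := Int.le_of_dvd (by positivity) h3
    rw [abs_mul, abs_of_pos (by norm_num : (0 : ℤ) < 4), ← sq_abs] at this
    nlinarith [abs_nonneg m]
  lift e to ℕ using he.le
  rw [Int.abs_eq_natAbs] at hm23
  obtain ⟨c, hc, hceq⟩ := exists_div_mem_of_quartic d (by simpa using hd') m.natAbs (by omega) e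
    (by omega) (by simpa using hm) (by rintro rfl; simp at he) ⟨N, by
      rw [Int.natCast_natAbs, (by decide : Even 4).pow_abs, sq_abs]
      rcases hd' with rfl | rfl | rfl | rfl <;> norm_num <;> linarith⟩
  refine ⟨c, hc, ?_⟩
  rw [Int.natCast_natAbs, sq_abs] at hceq
  have hc2 : (c.2 : ℚ) ≠ 0 := by
    simp only [smallFractions, List.mem_cons, List.not_mem_nil, or_false] at hc
    rcases hc with rfl | rfl | rfl | rfl | rfl | rfl | rfl | rfl | rfl | rfl | rfl | rfl <;>
      norm_num
  have heQ : ((e : ℤ) : ℚ) ^ 2 ≠ 0 := by exact_mod_cast (pow_pos he 2).ne'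
  rw [eq_num_div_den_of h1 h2, div_eq_div_iff heQ hc2]
  exact_mod_cast hceq

theorem equation_W_iff {x y : ℚ} :
    W.toAffine.Equation x y ↔ y ^ 2 = x ^ 3 + 5 * x ^ 2 - 32 * x := by
  rw [equation_iff]
  simp [W, sub_eq_add_neg]

theorem nonsingular_W {x y : ℚ} (h : y ^ 2 = x ^ 3 + 5 * x ^ 2 - 32 * x) :
    W.toAffine.Nonsingular x y := by
  rw [← equation_iff_nonsingular_of_Δ_ne_zero]
  · exact equation_W_iff.mpr h
  · norm_num [W, WeierstrassCurve.Δ, WeierstrassCurve.b₂, WeierstrassCurve.b₄,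
      WeierstrassCurve.b₆, WeierstrassCurve.b₈]

theorem generatorW_nonsingular : W.toAffine.Nonsingular (-4) 12 := nonsingular_W (by norm_num)

/-- The generator `(-4, 12)` of infinite order. -/
def generatorW : W.toAffine.Point := .some (-4) 12 generatorW_nonsingular

/-- The rational `2`-torsion point `(0, 0)`. -/
def torsionW : W.toAffine.Point := .some 0 0 (nonsingular_W (by norm_num))

theorem sq_eq_of_nonsingular {x y : ℚ} (h : W.toAffine.Nonsingular x y) :
    y ^ 2 = x ^ 3 + 5 * x ^ 2 - 32 * x := equation_W_iff.mp h.1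

theorem some_add_generatorW {x y x' : ℚ} (h : W.toAffine.Nonsingular x y) (hx : x ≠ -4)
    (hx' : x' = (-4 * x ^ 2 - 56 * x + 128 - 24 * y) / (x + 4) ^ 2) :
    ∃ y' h', Point.some x y h + generatorW = .some x' y' h' := by
  have key : W.toAffine.addX x (-4) (W.toAffine.slope x (-4) y 12) =
      (-4 * x ^ 2 - 56 * x + 128 - 24 * y) / (x + 4) ^ 2 := by
    rw [slope_of_X_ne hx]
    have : x + 4 ≠ 0 := fun h => hx (by linarith)
    simp only [addX, W, sub_neg_eq_add]
    field_simp
    linear_combination sq_eq_of_nonsingular h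
  rw [hx', ← key]
  exact ⟨_, _, Point.add_of_X_ne hx⟩

theorem some_add_torsionW {x y x' : ℚ} (h : W.toAffine.Nonsingular x y) (hx : x ≠ 0)
    (hx' : x' = -32 / x) : ∃ y' h', Point.some x y h + torsionW = .some x' y' h' := by
  have key : W.toAffine.addX x 0 (W.toAffine.slope x 0 y 0) = -32 / x := by
    rw [slope_of_X_ne hx]
    simp only [addX, W, sub_zero]
    field_simp
    linear_combination sq_eq_of_nonsingular h
  rw [hx', ← key]
  exact ⟨_, _, Point.add_of_X_ne hx⟩

theorem some_add_self {x y x' : ℚ} (h : W.toAffine.Nonsingular x y) (hy : y ≠ 0)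
    (hx' : x' = (x ^ 2 + 32) ^ 2 / (4 * y ^ 2)) :
    ∃ y' h', Point.some x y h + .some x y h = .some x' y' h' := by
  have hneg : y ≠ W.toAffine.negY x y := by
    simp only [negY, W]
    intro h0
    exact hy (by linarith)
  have key : W.toAffine.addX x x (W.toAffine.slope x x y y) =
      (x ^ 2 + 32) ^ 2 / (4 * y ^ 2) := by
    rw [slope_of_Y_ne rfl hneg]
    have : y - W.toAffine.negY x y = 2 * y := by simp only [negY, W]; ring
    rw [this]
    simp only [addX, W]
    field_simp
    linear_combination (-16 * (2 * x + 5)) * sq_eq_of_nonsingular h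
  rw [hx', ← key]
  exact ⟨_, _, Point.add_self_of_Y_ne hneg⟩

theorem torsionW_add_self : torsionW + torsionW = 0 :=
  Point.add_self_of_Y_eq (by simp [W])

section Generation

variable {K : AddSubgroup W.toAffine.Point}

theorem some_mem_of_some_mem {x y y' : ℚ} {h : W.toAffine.Nonsingular x y}
    {h' : W.toAffine.Nonsingular x y'} (hK : Point.some x y h ∈ K) : Point.some x y' h' ∈ K := by
  rcases (Point.X_eq_iff (h₁ := h') (h₂ := h)).mp rfl with h0 | h0 <;> rw [h0]
  · exact hK
  · exact K.neg_mem hK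

theorem mem_of_eq_neg_div (hT : torsionW ∈ K) {x x' : ℚ} (hx' : x' = -32 / x) (hx : x ≠ 0)
    (hK : ∀ y h, Point.some x y h ∈ K) (y : ℚ) (h : W.toAffine.Nonsingular x' y) :
    Point.some x' y h ∈ K := by
  have hx0 : x' ≠ 0 := by rw [hx']; exact div_ne_zero (by norm_num) hx
  obtain ⟨y', h', hadd⟩ := some_add_torsionW h hx0 (x' := x) (by rw [hx']; field_simp)
  rw [← K.add_mem_cancel_right hT, hadd]
  exact hK _ _

theorem mem_of_eq_add_generator (hP : generatorW ∈ K) {x x' : ℚ} (y : ℚ)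
    (hxy : y ^ 2 = x ^ 3 + 5 * x ^ 2 - 32 * x) (hx : x ≠ -4)
    (hx' : x' = (-4 * x ^ 2 - 56 * x + 128 - 24 * y) / (x + 4) ^ 2)
    (hK : ∀ y h, Point.some x y h ∈ K) (y' : ℚ) (h' : W.toAffine.Nonsingular x' y') :
    Point.some x' y' h' ∈ K := by
  obtain ⟨y'', h'', hadd⟩ := some_add_generatorW (nonsingular_W hxy) hx hx'
  exact some_mem_of_some_mem (hadd ▸ K.add_mem (hK _ _) hP)

theorem mem_of_ratHeight_le (hP : generatorW ∈ K) (hT : torsionW ∈ K) {x y : ℚ}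
    (h : W.toAffine.Nonsingular x y) (hx : x ≠ 0) (hH : ratHeight (x / 4) ≤ 126) :
    Point.some x y h ∈ K := by
  have h1 : ∀ y h, Point.some (-4) y h ∈ K := fun y h => some_mem_of_some_mem hP
  have h2 : ∀ y h, Point.some 4 y h ∈ K := fun y h => by
    obtain ⟨y', h', hadd⟩ := some_add_self (x' := 4) generatorW_nonsingular
      (by norm_num) (by norm_num)
    exact some_mem_of_some_mem (hadd ▸ K.add_mem hP hP)
  have h3 : ∀ y h, Point.some (-1) y h ∈ K :=
    mem_of_eq_add_generator hP (x := 4) (-4) (by norm_num) (by norm_num) (by norm_num) h2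
  have h4 : ∀ y h, Point.some 36 y h ∈ K :=
    mem_of_eq_add_generator hP (x := -1) (-6) (by norm_num) (by norm_num) (by norm_num) h3
  have h5 : ∀ y h, Point.some (-196 / 25) y h ∈ K :=
    mem_of_eq_add_generator hP (x := 36) 228 (by norm_num) (by norm_num) (by norm_num) h4
  have h6 : ∀ y h, Point.some (121 / 16) y h ∈ K :=
    mem_of_eq_add_generator hP (x := -196 / 25) (1092 / 125) (by norm_num) (by norm_num)
      (by norm_num) h5
  obtain ⟨c, hc, hxc⟩ := exists_div_of_ratHeight_le hx (sq_eq_of_nonsingular h) hH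
  simp only [smallFractions, List.mem_cons, List.not_mem_nil, or_false] at hc
  rcases hc with rfl | rfl | rfl | rfl | rfl | rfl | rfl | rfl | rfl | rfl | rfl | rfl <;>
    push_cast at hxc <;> try rw [div_one] at hxc
  · subst hxc; exact h1 y h
  · exact mem_of_eq_neg_div hT (by rw [hxc]; norm_num) (by norm_num) h1 y h
  · subst hxc; exact h2 y h
  · exact mem_of_eq_neg_div hT (by rw [hxc]; norm_num) (by norm_num) h2 y h
  · subst hxc; exact h3 y h
  · exact mem_of_eq_neg_div hT (by rw [hxc]; norm_num) (by norm_num) h3 y h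
  · subst hxc; exact h4 y h
  · exact mem_of_eq_neg_div hT (by rw [hxc]; norm_num) (by norm_num) h4 y h
  · subst hxc; exact h5 y h
  · exact mem_of_eq_neg_div hT (by rw [hxc]; norm_num) (by norm_num) h5 y h
  · subst hxc; exact h6 y h
  · exact mem_of_eq_neg_div hT (by rw [hxc]; norm_num) (by norm_num) h6 y h

/-- Every point of `W` can be translated by an element of `K` to a point whose `x`-coordinate is a
square, with control on the height. -/
theorem exists_translate_sq (hP : generatorW ∈ K) (hT : torsionW ∈ K) {x y : ℚ}
    (h : W.toAffine.Nonsingular x y) (hx : x ≠ 0) : Point.some x y h ∈ K ∨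
      ∃ r y' h', r ≠ 0 ∧ (Point.some (r ^ 2) y' h' ∈ K → Point.some x y h ∈ K) ∧
        ratHeight (r ^ 2 / 4) ≤ 26 * ratHeight (x / 4) ^ 2 := by
  rcases eq_or_ne x (-4) with rfl | hx4
  · exact .inl (some_mem_of_some_mem hP)
  have hE := sq_eq_of_nonsingular h
  obtain ⟨x₁, hx₁⟩ : ∃ x₁, x₁ = (-4 * x ^ 2 - 56 * x + 128 - 24 * y) / (x + 4) ^ 2 := ⟨_, rfl⟩
  obtain ⟨y₁, h₁, hadd₁⟩ := some_add_generatorW h hx4 hx₁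
  have hx4' : x + 4 ≠ 0 := fun h => hx4 (by linarith)
  have hmem₁ : Point.some x₁ y₁ h₁ ∈ K → Point.some x y h ∈ K := fun hK => by
    rw [← K.add_mem_cancel_right hP, hadd₁]; exact hK
  rcases eq_or_ne x₁ 0 with rfl | hx₁0
  · exact .inl (hmem₁ (some_mem_of_some_mem hT))
  have hH := ratHeight_translate_le (x := x / 4) (z := y / 4)
    (fun h => hx4 (by linarith)) (by linear_combination hE / 16)
  have hX : (-2 * (x / 4) ^ 2 - 7 * (x / 4) + 4 - 3 * (y / 4)) / (2 * (x / 4 + 1) ^ 2) =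
      x₁ / 4 := by
    rw [hx₁]; field_simp; ring
  rw [hX] at hH
  have hprod : x * x₁ = - ((6 * x + 2 * y) / (x + 4)) ^ 2 := by
    rw [hx₁]; field_simp; linear_combination 4 * hE
  set ν := (6 * x + 2 * y) / (x + 4)
  have hν : ν ≠ 0 := fun h0 => mul_ne_zero hx hx₁0 (by rw [hprod, h0]; ring)
  right
  obtain ⟨r, hr, hr' | hr' | hr' | hr'⟩ := squareclass_W hx hE
  · subst hr'
    have : 0 < ratHeight (r ^ 2 / 4) := ratHeight_pos _
    exact ⟨r, y, h, hr, id, by nlinarith⟩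
  · have : x₁ = (ν / r) ^ 2 := by
      rw [hr'] at hprod; field_simp; linarith
    subst this
    exact ⟨ν / r, y₁, h₁, div_ne_zero hν hr, hmem₁, hH.1⟩
  · have hsq : (8 * r / ν) ^ 2 = -32 / x₁ := by
      rw [hr'] at hprod; field_simp; linarith
    obtain ⟨y₂, h₂, hadd₂⟩ := some_add_torsionW h₁ hx₁0 hsq
    refine ⟨8 * r / ν, y₂, h₂, by positivity, fun hK => hmem₁ ?_, ?_⟩
    · rw [← K.add_mem_cancel_right hT, hadd₂]; exact hK
    · rw [hsq]
      convert hH.2 using 2; field_simp; norm_num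
  · have hsq : (4 / r) ^ 2 = -32 / x := by
      rw [hr']; field_simp; norm_num
    obtain ⟨y₂, h₂, hadd₂⟩ := some_add_torsionW h hx hsq
    refine ⟨4 / r, y₂, h₂, by positivity, fun hK => ?_, ?_⟩
    · rw [← K.add_mem_cancel_right hT, hadd₂]; exact hK
    · rw [hsq]
      convert ratHeight_neg_two_div_le (x := x / 4) (by positivity) using 2; field_simp; norm_num

theorem ratHeight_double_ge {x y : ℚ} (hy : y ≠ 0) (h : y ^ 2 = x ^ 3 + 5 * x ^ 2 - 32 * x) :
    ratHeight (x / 4) ^ 4 ≤ 612 * ratHeight ((x ^ 2 + 32) ^ 2 / (4 * y ^ 2) / 4) := by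
  have h0 : x / 4 * (4 * (x / 4) ^ 2 + 5 * (x / 4) - 8) = y ^ 2 / 16 := by
    linear_combination -h / 16
  convert ratHeight_pow_four_le (x := x / 4) (by rw [h0]; positivity) using 3
  rw [h0]
  field_simp
  ring

theorem mem_of_generators (hP : generatorW ∈ K) (hT : torsionW ∈ K) (Q : W.toAffine.Point) :
    Q ∈ K := by
  suffices ∀ n : ℕ, ∀ x y h, ratHeight (x / 4) = n → Point.some x y h ∈ K by
    rcases Q with _ | ⟨x, y, h⟩
    · exact K.zero_mem
    · exact this _ x y h rfl
  intro n
  induction n using Nat.strong_induction_on with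
  | _ n ih =>
    rintro x y h rfl
    rcases eq_or_ne x 0 with rfl | hx
    · exact some_mem_of_some_mem hT
    rcases le_or_gt (ratHeight (x / 4)) 126 with hle | hgt
    · exact mem_of_ratHeight_le hP hT h hx hle
    obtain hK | ⟨r, y', h', hr, hmem, hH⟩ := exists_translate_sq hP hT h hx
    · exact hK
    apply hmem
    obtain ⟨u, v, hv, huv, hur⟩ := exists_half hr (sq_eq_of_nonsingular h')
    have hH2 := ratHeight_double_ge hv huv
    obtain ⟨y'', h'', hadd⟩ := some_add_self (nonsingular_W huv) hv hur.symm
    rw [hur] at hH2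
    have hlt : ratHeight (u / 4) < ratHeight (x / 4) := by
      by_contra! hge
      have h3 := Nat.pow_le_pow_left hge 4
      have h4 : ratHeight (x / 4) ^ 4 ≤ 15912 * ratHeight (x / 4) ^ 2 := by omega
      have h5 : 127 ^ 2 ≤ ratHeight (x / 4) ^ 2 := Nat.pow_le_pow_left hgt 2
      nlinarith
    have := ih _ hlt u v (nonsingular_W huv) rfl
    exact some_mem_of_some_mem (hadd ▸ K.add_mem this this)

end Generation

theorem ne_zero_of_ratHeight {x y : ℚ} (h : y ^ 2 = x ^ 3 + 5 * x ^ 2 - 32 * x)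
    (hH : 1 < ratHeight (x / 4)) : y ≠ 0 := by
  rintro rfl
  have hx : x ≠ 0 := by rintro rfl; simp [ratHeight] at hH
  have h0 : x ^ 2 + 5 * x - 32 = 0 := by
    apply mul_left_cancel₀ hx
    linear_combination -h
  have hsq : IsSquare ((153 : ℤ) : ℚ) := ⟨2 * x + 5, by push_cast; linear_combination -4 * h0⟩
  rw [Rat.isSquare_intCast_iff] at hsq
  exact absurd hsq (by decide +kernel)

/-- Doubling strictly increases the height of points of height at least `9`. -/
theorem exists_nsmul_generatorW (n : ℕ) : ∃ x y h, 9 + n ≤ ratHeight (x / 4) ∧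
    (2 ^ (n + 2)) • generatorW = Point.some x y h := by
  induction n with
  | zero =>
    obtain ⟨y, h, hadd⟩ := some_add_self (x' := 4) generatorW_nonsingular
      (by norm_num) (by norm_num)
    have hE := sq_eq_of_nonsingular h
    obtain ⟨y', h', hadd'⟩ := some_add_self (x' := 36) h (by rintro rfl; norm_num at hE)
      (by rw [hE]; norm_num)
    refine ⟨36, y', h', by norm_num [ratHeight], ?_⟩
    rw [← hadd', ← hadd]
    change 4 • generatorW = generatorW + generatorW + (generatorW + generatorW)
    abel
  | succ n ih =>
    obtain ⟨x, y, h, hH, hP⟩ := ih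
    have hE := sq_eq_of_nonsingular h
    have hy := ne_zero_of_ratHeight hE (by omega)
    obtain ⟨y', h', hadd⟩ := some_add_self h hy rfl
    refine ⟨_, y', h', ?_, by rw [← hadd, ← hP, ← two_nsmul, ← mul_nsmul, ← pow_succ]⟩
    have hdouble := ratHeight_double_ge hy hE
    have : 9 ^ 3 ≤ ratHeight (x / 4) ^ 3 := Nat.pow_le_pow_left (by omega) 3
    nlinarith

theorem not_isOfFinAddOrder_generatorW : ¬ IsOfFinAddOrder generatorW := by
  intro hfin
  let f : W.toAffine.Point → ℕ
    | .zero => 0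
    | .some x _ _ => ratHeight (x / 4)
  obtain ⟨B, hB⟩ := ((finite_multiples.mpr hfin).image f).bddAbove
  obtain ⟨x, y, h, hH, hP⟩ := exists_nsmul_generatorW B
  have : ratHeight (x / 4) ≤ B := hB ⟨_, ⟨_, hP⟩, rfl⟩
  omega

/-- The homomorphism `(n, ε) ↦ n P + ε T`. -/
def mordellWeilHom : ℤ × ZMod 2 →+ W.toAffine.Point :=
  (zmultiplesHom _ generatorW).coprod
    (ZMod.lift 2 ⟨zmultiplesHom _ torsionW, by
      simp [two_zsmul, torsionW_add_self]⟩)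

theorem mordellWeilHom_one_zero : mordellWeilHom (1, 0) = generatorW := by simp [mordellWeilHom]

theorem mordellWeilHom_zero_one : mordellWeilHom (0, 1) = torsionW := by
  rw [← Int.cast_one (R := ZMod 2), mordellWeilHom, AddMonoidHom.coprod_apply, ZMod.lift_coe]
  simp

theorem mordellWeilHom_injective : Function.Injective mordellWeilHom := by
  rw [injective_iff_map_eq_zero]
  rintro ⟨n, ε⟩ h
  obtain rfl : n = 0 := by
    by_contra hn
    refine not_isOfFinAddOrder_generatorW (isOfFinAddOrder_iff_zsmul_eq_zero.mpr
      ⟨2 * n, mul_ne_zero two_ne_zero hn, ?_⟩)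
    have h2 : (2 * n) • ((1, 0) : ℤ × ZMod 2) = (n, ε) + (n, ε) := by
      ext
      · simp [two_mul]
      · simp [CharTwo.add_self_eq_zero]
    rw [← mordellWeilHom_one_zero, ← map_zsmul, h2, map_add, h, add_zero]
  fin_cases ε
  · rfl
  · exact absurd (mordellWeilHom_zero_one.symm.trans h) (Point.some_ne_zero _)

end

/-- The Mordell–Weil group `W(ℚ)` of the elliptic curve `y² = x³ + 5x² − 32x` is isomorphic
to `ℤ ⊕ ℤ/2ℤ`; in particular the rank of `W` over `ℚ` equals `1`. -/
theorem mordell_weil_of_W :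
    Nonempty (W.toAffine.Point ≃+ ℤ × ZMod 2) :=
  ⟨(AddEquiv.ofBijective mordellWeilHom ⟨mordellWeilHom_injective, fun Q =>
    mem_of_generators (K := mordellWeilHom.range) ⟨_, mordellWeilHom_one_zero⟩
      ⟨_, mordellWeilHom_zero_one⟩ Q⟩).symm⟩
end

section
/- Rational points are dense on the real locus of the curve y² = x³ + 5x² − 32x: the closure in ℝ² (with the Euclidean topology) of the set {(x, y) ∈ ℚ² : y² = x³ + 5x² − 32x} equals the set {(x, y) ∈ ℝ² : y² = x³ + 5x² − 32x}. -/
/-- The chord through two points of the curve with `y₁ + y₂ ≠ 0` (the tangent if the points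
coincide), of slope `m`, meets the curve in the points with abscissae `x₁`, `x₂` and
`m ^ 2 - 5 - x₁ - x₂`. -/
theorem chord_intersections {K : Type*} [Field K] {x₁ y₁ x₂ y₂ m : K}
    (h₁ : y₁ ^ 2 = x₁ ^ 3 + 5 * x₁ ^ 2 - 32 * x₁)
    (h₂ : y₂ ^ 2 = x₂ ^ 3 + 5 * x₂ ^ 2 - 32 * x₂) (hy : y₁ + y₂ ≠ 0)
    (hm : m * (y₁ + y₂) = x₁ ^ 2 + x₁ * x₂ + x₂ ^ 2 + 5 * (x₁ + x₂) - 32) (t : K) :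
    t ^ 3 + 5 * t ^ 2 - 32 * t - (y₁ + m * (t - x₁)) ^ 2 =
      (t - x₁) * (t - x₂) * (t - (m ^ 2 - 5 - x₁ - x₂)) := by
  have hs : y₂ - y₁ = m * (x₂ - x₁) := by
    apply mul_right_cancel₀ hy
    linear_combination h₂ - h₁ - (x₂ - x₁) * hm
  linear_combination (-1) * h₁ - (t - x₁) * hm + m * (t - x₁) * hs

theorem exists_mul_eq_of_pos {x₁ y₁ x₂ y₂ : ℚ} (hx₁ : 3 ≤ x₁) (hx₂ : 3 ≤ x₂) (hy : 0 < y₁ + y₂) :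
    ∃ m : ℚ, 0 < m ∧ m * (y₁ + y₂) = x₁ ^ 2 + x₁ * x₂ + x₂ ^ 2 + 5 * (x₁ + x₂) - 32 := by
  refine ⟨(x₁ ^ 2 + x₁ * x₂ + x₂ ^ 2 + 5 * (x₁ + x₂) - 32) / (y₁ + y₂), ?_, by field_simp⟩
  apply div_pos _ hy
  nlinarith

theorem three_le_of_nonneg {x : ℚ} (hx : 0 < x) (h : 0 ≤ x ^ 2 + 5 * x - 32) : 3 ≤ x := by
  nlinarith

theorem three_le_of_mem {x y : ℚ} (hx : 0 < x) (h : y ^ 2 = x ^ 3 + 5 * x ^ 2 - 32 * x) :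
    3 ≤ x := by
  refine three_le_of_nonneg hx (nonneg_of_mul_nonneg_right (a := x) ?_ hx)
  nlinarith [sq_nonneg y]

/-- If `(X, Y)` is close to the point at infinity, translation by it does not move a point with
`b ≤ x` to a point with `x' ≤ a`. -/
theorem lt_third_abscissa {a b x y X x' y' m : ℚ} (ha : 0 < a) (hab : a < b)
    (hga : 0 ≤ a ^ 2 + 5 * a - 32)
    (hX₁ : (12 * a + 6 + a ^ 3 + 5 * a ^ 2) * b ^ 2 < X * (b - a) ^ 2) (hbx : b ≤ x) (hX : 0 < X)
    (hx' : 0 < x') (h : y ^ 2 = x ^ 3 + 5 * x ^ 2 - 32 * x)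
    (h' : y' ^ 2 = x' ^ 3 + 5 * x' ^ 2 - 32 * x') (hm : m ^ 2 = X + 5 + x + x')
    (hslope : m * (x - x') = y + y') : a < x' := by
  by_contra! hle
  have hx0 : 0 < x := by linarith
  have h3 := three_le_of_nonneg ha hga
  have hyy : 2 * y * y' ≤ x ^ 2 + 5 * x - 32 + x * y' ^ 2 := by
    apply le_of_mul_le_mul_left _ hx0
    linarith [sq_nonneg (y - x * y')]
  have hy'2 : y' ^ 2 ≤ a ^ 3 + 5 * a ^ 2 := by
    have : x' ^ 3 ≤ a ^ 3 := by gcongr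
    have : x' ^ 2 ≤ a ^ 2 := by gcongr
    linarith
  have hxx : x ≤ x ^ 2 := by nlinarith only [hbx, hab, h3]
  have h1 : x * y' ^ 2 ≤ x ^ 2 * (a ^ 3 + 5 * a ^ 2) := by gcongr
  have h2 : x * x' * (x + x') ≤ x * a * (x + x) := by gcongr; linarith
  have h4 : x * x' ≤ x ^ 2 * a := by gcongr
  have h5 : X * (x - x') ^ 2 ≤ (12 * a + 6 + a ^ 3 + 5 * a ^ 2) * x ^ 2 := by
    have : X * (x - x') ^ 2 =
        x * x' * (x + x') + 10 * (x * x') - 32 * (x + x') + 2 * y * y' := by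
      linear_combination h + h' - (x - x') ^ 2 * hm + (m * (x - x') + y + y') * hslope
    rw [this]; linarith
  have h6 : (b - a) * x ≤ (x - x') * b := by
    have := mul_le_mul_of_nonneg_right hle (ha.trans hab).le
    have := mul_le_mul_of_nonneg_left hbx ha.le
    linarith
  have h7 : X * ((b - a) * x) ^ 2 ≤ X * ((x - x') * b) ^ 2 := by
    have : 0 ≤ (b - a) * x := mul_nonneg (by linarith) hx0.le
    gcongr
  have h8 : X * (x - x') ^ 2 * b ^ 2 ≤ (12 * a + 6 + a ^ 3 + 5 * a ^ 2) * x ^ 2 * b ^ 2 := by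
    gcongr
  linarith [mul_lt_mul_of_pos_right hX₁ (pow_pos hx0 2)]

/-- A line of positive slope that meets the curve at `X`, close to infinity, and at `x, x' ≥ b`
cannot meet it in the closed upper half-plane only. -/
theorem third_ordinate_neg {a b x y X x' m : ℚ} (ha : 0 < a) (hab : a < b)
    (hga : 0 ≤ a ^ 2 + 5 * a - 32) (hX₂ : 32 * a < (b - a) ^ 2 * (X - a)) (hbx : b ≤ x)
    (hbx' : b ≤ x') (hX : 0 < X) (hm : 0 < m) (hy : 0 < y) (hY : 0 < y + m * (X - x))
    (hy' : 0 ≤ y + m * (x' - x))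
    (key : ∀ t, t ^ 3 + 5 * t ^ 2 - 32 * t - (y + m * (t - x)) ^ 2 =
      (t - x) * (t - X) * (t - x')) : False := by
  have hx0 : 0 < x := by linarith
  have hx'0 : 0 < x' := by linarith
  obtain ⟨z, hz⟩ : ∃ z, y = m * (x - z) := ⟨x - y / m, by field_simp; ring⟩
  have hzx : 0 < x - z := pos_of_mul_pos_right (hz ▸ hy) hm.le
  have hzX : 0 < X - z := by
    refine pos_of_mul_pos_right (?_ : 0 < m * (X - z)) hm.le
    linarith
  have hzx' : 0 ≤ x' - z := by
    refine nonneg_of_mul_nonneg_right (?_ : 0 ≤ m * (x' - z)) hm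
    linarith
  have hz0 : 0 < z := by
    have hc : x * X + x * x' + X * x' = -32 + 2 * m ^ 2 * z := by
      have h1 := key 1
      have h2 := key (-1)
      rw [hz] at h1 h2
      linarith
    have : 0 < m ^ 2 * z := by linarith [mul_pos hx0 hX, mul_pos hx0 hx'0, mul_pos hX hx'0]
    exact pos_of_mul_pos_right this (by positivity)
  have e : (x - z) * (X - z) * (x' - z) = z * (32 - 5 * z - z ^ 2) := by
    have := key z
    rw [hz] at this
    linear_combination this
  have hza : z ≤ a := by
    by_contra! hlt
    have : 0 ≤ (x - z) * (X - z) * (x' - z) := by positivity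
    have : 0 < z * (z ^ 2 + 5 * z - 32) := mul_pos hz0 (by nlinarith)
    linarith
  have hXa : 0 < X - a := pos_of_mul_pos_right (by linarith) (sq_nonneg (b - a))
  have : (b - a) * (X - a) * (b - a) ≤ (x - z) * (X - z) * (x' - z) := by
    have : 0 ≤ b - a := by linarith
    gcongr
  nlinarith [mul_pos hz0 hz0, pow_pos hz0 3]

/-- Adding the point `(X, Y)`, which is close to the point at infinity, moves a point `(x, y)` of
the upper branch down, without jumping over the strip `a < x < b`. -/
theorem exists_step {a b x y X Y : ℚ} (ha : 0 < a) (hab : a < b) (hga : 0 ≤ a ^ 2 + 5 * a - 32)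
    (hX₁ : (12 * a + 6 + a ^ 3 + 5 * a ^ 2) * b ^ 2 < X * (b - a) ^ 2)
    (hX₂ : 32 * a < (b - a) ^ 2 * (X - a)) (hbx : b ≤ x) (hy : 0 < y) (hY : 0 < Y)
    (hX : 0 < X) (h : y ^ 2 = x ^ 3 + 5 * x ^ 2 - 32 * x)
    (H : Y ^ 2 = X ^ 3 + 5 * X ^ 2 - 32 * X) :
    ∃ x' y' : ℚ, y' ^ 2 = x' ^ 3 + 5 * x' ^ 2 - 32 * x' ∧ a < x' ∧
      (x' < b ∨ b ≤ x' ∧ x' < x ∧ 0 < y' ∧ y ^ 2 ≤ (X + 5 + x + x') * (x - x') ^ 2) := by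
  have hx0 : 0 < x := by linarith
  obtain ⟨m, hm, hmN⟩ :=
    exists_mul_eq_of_pos (three_le_of_mem hx0 h) (three_le_of_mem hX H) (add_pos hy hY)
  have key := chord_intersections h H (by positivity) hmN
  obtain ⟨x', hx'⟩ : ∃ x', x' = m ^ 2 - 5 - x - X := ⟨_, rfl⟩
  obtain ⟨y', hy'⟩ : ∃ y', y' = -(y + m * (x' - x)) := ⟨_, rfl⟩
  rw [← hx'] at key
  have hcurve : y' ^ 2 = x' ^ 3 + 5 * x' ^ 2 - 32 * x' := by
    rw [hy']; linear_combination -key x'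
  have hm2 : m ^ 2 = X + 5 + x + x' := by rw [hx']; ring
  have hslope : m * (x - x') = y + y' := by rw [hy']; ring
  have hx'0 : 0 < x' := by
    have h0 : 0 ≤ (x * X) * x' := by
      have := key 0
      nlinarith [sq_nonneg (y + m * (0 - x))]
    refine lt_of_le_of_ne (nonneg_of_mul_nonneg_right h0 (by positivity)) fun h0' => ?_
    rw [← h0'] at hcurve hslope hm2
    have hy0 : y' = 0 := by
      apply pow_eq_zero_iff (two_ne_zero) |>.1; rw [hcurve]; ring
    have h1 : y ^ 2 = m ^ 2 * x ^ 2 := by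
      rw [← mul_pow]; congr 1; linarith
    have : x ^ 2 * X + 32 * x = 0 := by rw [hm2, h] at h1; linear_combination -h1
    have : 0 < x ^ 2 * X + 32 * x := by positivity
    linarith
  have hax' := lt_third_abscissa ha hab hga hX₁ hbx hX hx'0 h hcurve hm2 hslope
  refine ⟨x', y', hcurve, hax', ?_⟩
  rcases lt_or_ge x' b with hlt | hge
  · exact Or.inl hlt
  have hline : Y = y + m * (X - x) := by
    apply mul_right_cancel₀ (add_pos hy hY).ne'
    linear_combination H - h - (X - x) * hmN
  have hy'0 : 0 < y' := by
    by_contra! hneg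
    refine third_ordinate_neg ha hab hga hX₂ hbx hge hX hm hy ?_ ?_ key
    · rw [← hline]; exact hY
    · linarith
  refine Or.inr ⟨hge, by nlinarith, hy'0, ?_⟩
  rw [← hm2, ← mul_pow, hslope]
  nlinarith

theorem exists_double {x y : ℚ} (hx : 0 < x) (hy : y ≠ 0)
    (h : y ^ 2 = x ^ 3 + 5 * x ^ 2 - 32 * x) :
    ∃ x' y' : ℚ, 0 < x' ∧ y' ^ 2 = x' ^ 3 + 5 * x' ^ 2 - 32 * x' ∧
      x' * (4 * (x ^ 3 + 5 * x ^ 2 - 32 * x)) = (x ^ 2 + 32) ^ 2 := by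
  have hy2 : y + y ≠ 0 := by simpa [← two_mul] using hy
  obtain ⟨m, hm⟩ : ∃ m, m * (y + y) = x ^ 2 + x * x + x ^ 2 + 5 * (x + x) - 32 :=
    ⟨_, div_mul_cancel₀ _ hy2⟩
  have key := chord_intersections h h hy2 hm
  have hx' : (m ^ 2 - 5 - x - x) * (4 * (x ^ 3 + 5 * x ^ 2 - 32 * x)) = (x ^ 2 + 32) ^ 2 := by
    rw [← h]
    have : (m * (y + y)) ^ 2 = _ := congrArg (· ^ 2) hm
    linear_combination this - 4 * (5 + 2 * x) * h
  refine ⟨m ^ 2 - 5 - x - x, y + m * (m ^ 2 - 5 - x - x - x), ?_, ?_, hx'⟩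
  · refine pos_of_mul_pos_left (b := 4 * (x ^ 3 + 5 * x ^ 2 - 32 * x)) ?_ ?_
    · rw [hx']; positivity
    · rw [← h]; positivity
  · linear_combination -key (m ^ 2 - 5 - x - x)

theorem exists_point_of_denominator (k : ℕ) :
    ∃ x y : ℚ, ∃ r s : ℤ, 0 < x ∧ y ^ 2 = x ^ 3 + 5 * x ^ 2 - 32 * x ∧ Odd r ∧ Odd s ∧
      x * (4 ^ (k + 2) * s) = r := by
  induction k with
  | zero =>
    exact ⟨121 / 16, 1397 / 64, 121, 1, by norm_num, by norm_num, by decide, by decide,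
      by norm_num⟩
  | succ k ih =>
    obtain ⟨x, y, r, s, hx, h, hr, hs, e⟩ := ih
    obtain ⟨q, hqe⟩ : ∃ q : ℤ, q = 4 ^ (k + 2) * s := ⟨_, rfl⟩
    have hq : Even q := by
      rw [hqe]
      exact ((by decide : Even (4 : ℤ)).pow_of_ne_zero (by simp)).mul_right s
    have e' : x * q = r := by rw [hqe]; push_cast; exact e
    have hodd : Odd (r ^ 2 + (5 * r * q - 32 * q ^ 2)) :=
      hr.pow.add_even ((hq.mul_left _).sub ((by decide : Even (32 : ℤ)).mul_right _))
    have hf : (x ^ 3 + 5 * x ^ 2 - 32 * x) * q ^ 3 =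
        ((r * (r ^ 2 + (5 * r * q - 32 * q ^ 2)) : ℤ) : ℚ) := by
      push_cast
      rw [← e']; ring
    have hy : y ≠ 0 := by
      rintro rfl
      rw [← h, zero_pow two_ne_zero, zero_mul] at hf
      have h0 := hr.mul hodd
      rw [show r * (r ^ 2 + (5 * r * q - 32 * q ^ 2)) = 0 by exact_mod_cast hf.symm] at h0
      exact absurd h0 (by decide)
    obtain ⟨x', y', hx', h', hd⟩ := exists_double hx hy h
    refine ⟨x', y', (r ^ 2 + 32 * q ^ 2) ^ 2, s * (r * (r ^ 2 + (5 * r * q - 32 * q ^ 2))), hx', h',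
      (hr.pow.add_even ((by decide : Even (32 : ℤ)).mul_right _)).pow, hs.mul (hr.mul hodd), ?_⟩
    rw [Int.cast_mul s, ← hf]
    have hqe' : (q : ℚ) = 4 ^ (k + 2) * s := by rw [hqe]; push_cast; rfl
    push_cast
    rw [← e']
    linear_combination (q : ℚ) ^ 4 * hd - 4 * x' * (x ^ 3 + 5 * x ^ 2 - 32 * x) * q ^ 3 * hqe'

theorem infinite_abscissae :
    {x : ℚ | 0 < x ∧ ∃ y : ℚ, y ^ 2 = x ^ 3 + 5 * x ^ 2 - 32 * x}.Infinite := by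
  choose x y r s hx h hr hs e using exists_point_of_denominator
  refine Set.infinite_of_injective_forall_mem (f := x) ?_ fun k => ⟨hx k, y k, h k⟩
  intro i j heq
  by_contra hne
  wlog hij : i < j generalizing i j
  · exact this heq.symm (Ne.symm hne) (lt_of_le_of_ne (not_lt.1 hij) (Ne.symm hne))
  obtain ⟨d, rfl⟩ := Nat.exists_eq_add_of_lt hij
  have hZ : r (i + d + 1) * s i = 4 ^ (d + 1) * (s (i + d + 1) * r i) := by
    have h2 := e (i + d + 1)
    rw [← heq] at h2
    have : (r (i + d + 1) * s i : ℚ) = 4 ^ (d + 1) * (s (i + d + 1) * r i) := by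
      rw [← e i, ← h2]; ring
    exact_mod_cast this
  have hodd := (hr (i + d + 1)).mul (hs i)
  rw [hZ, ← Int.not_even_iff_odd] at hodd
  exact hodd (((by decide : Even (4 : ℤ)).pow_of_ne_zero (by simp)).mul_right _)

/-- The difference of two points with nearby abscissae is close to the point at infinity. -/
theorem exists_difference {x₁ y₁ x₂ y₂ : ℚ} (hx₁ : 0 < x₁) (hy₁ : 0 ≤ y₁) (hy₂ : 0 ≤ y₂)
    (h₁ : y₁ ^ 2 = x₁ ^ 3 + 5 * x₁ ^ 2 - 32 * x₁)
    (h₂ : y₂ ^ 2 = x₂ ^ 3 + 5 * x₂ ^ 2 - 32 * x₂) (hlt : x₁ < x₂) :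
    ∃ X Y : ℚ, Y ^ 2 = X ^ 3 + 5 * X ^ 2 - 32 * X ∧ 1 ≤ X * (x₂ - x₁) := by
  have hd : 0 < x₂ - x₁ := sub_pos.2 hlt
  obtain ⟨m, hm⟩ : ∃ m, m * (x₂ - x₁) = y₁ + y₂ := ⟨_, div_mul_cancel₀ _ hd.ne'⟩
  have hX : (m ^ 2 - 5 - x₁ - x₂) * (x₂ - x₁) ^ 2 =
      x₁ * (x₁ * x₂ + 5 * x₂ - 32) + x₂ * (x₁ * x₂ + 5 * x₁ - 32) + 2 * y₁ * y₂ := by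
    have : (m * (x₂ - x₁)) ^ 2 = _ := congrArg (· ^ 2) hm
    linear_combination this + h₁ + h₂
  refine ⟨m ^ 2 - 5 - x₁ - x₂, -y₁ + m * (m ^ 2 - 5 - x₁ - x₂ - x₁), ?_, ?_⟩
  · apply mul_right_cancel₀ hd.ne'
    linear_combination (x₂ - x₁) * h₁ - (m ^ 2 - 5 - x₁ - x₂ - x₁) *
      (h₁ - h₂ - (m * (x₂ - x₁) + y₂ - y₁) * hm)
  · have h3 := three_le_of_mem hx₁ h₁
    have hg : 0 ≤ x₁ ^ 2 + 5 * x₁ - 32 :=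
      nonneg_of_mul_nonneg_right (a := x₁) (by nlinarith [sq_nonneg y₁]) hx₁
    apply le_of_mul_le_mul_right _ hd
    have e : (m ^ 2 - 5 - x₁ - x₂) * (x₂ - x₁) * (x₂ - x₁) =
        (x₁ + x₂) * (x₁ ^ 2 + 5 * x₁ - 32) + (x₁ * (x₁ + 5) + x₂ * x₁) * (x₂ - x₁)
          + 2 * (y₁ * y₂) := by
      linear_combination hX
    have hyy := mul_nonneg hy₁ hy₂
    have hs : 0 ≤ (x₁ + x₂) * (x₁ ^ 2 + 5 * x₁ - 32) := mul_nonneg (by linarith) hg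
    have : 1 * (x₂ - x₁) ≤ (x₁ * (x₁ + 5) + x₂ * x₁) * (x₂ - x₁) := by
      gcongr; nlinarith
    linarith

theorem exists_point_gt (K : ℚ) :
    ∃ X Y : ℚ, K < X ∧ 0 < Y ∧ Y ^ 2 = X ^ 3 + 5 * X ^ 2 - 32 * X := by
  suffices ∃ X Y : ℚ, |K| + 32 < X ∧ Y ^ 2 = X ^ 3 + 5 * X ^ 2 - 32 * X by
    obtain ⟨X, Y, hX, h⟩ := this
    have hX32 : 32 < X := by linarith [abs_nonneg K]
    refine ⟨X, |Y|, by linarith [le_abs_self K], abs_pos.2 ?_, by rwa [sq_abs]⟩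
    rintro rfl
    have : 0 < X * (X ^ 2 + 5 * X - 32) := mul_pos (by linarith) (by nlinarith)
    linarith
  obtain ⟨C, hC⟩ : ∃ C, C = |K| + 32 := ⟨_, rfl⟩
  rw [← hC]
  have hC0 : 0 < C := by linarith [abs_nonneg K]
  by_contra! hcon
  let S := {x : ℚ | 0 < x ∧ ∃ y : ℚ, y ^ 2 = x ^ 3 + 5 * x ^ 2 - 32 * x}
  have hmaps : Set.MapsTo (fun x : ℚ => ⌊x * C⌋) S (Set.Icc 0 ⌊C * C⌋) := by
    rintro x ⟨hx, y, h⟩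
    refine ⟨Int.floor_nonneg.2 (by positivity), Int.floor_le_floor ?_⟩
    gcongr
    by_contra! hlt
    exact hcon x y hlt h
  obtain ⟨x₁, ⟨hx₁, y₁, h₁⟩, x₂, ⟨hx₂, y₂, h₂⟩, hne, hfl⟩ :=
    infinite_abscissae.exists_ne_map_eq_of_mapsTo hmaps (Set.finite_Icc _ _)
  wlog hlt : x₁ < x₂ generalizing x₁ x₂ y₁ y₂
  · exact this x₂ hx₂ y₂ h₂ x₁ hx₁ y₁ h₁ hne.symm hfl.symm
      (lt_of_le_of_ne (not_lt.1 hlt) hne.symm)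
  obtain ⟨X, Y, h, hX⟩ := exists_difference hx₁ (abs_nonneg y₁) (abs_nonneg y₂)
    (by rwa [sq_abs]) (by rwa [sq_abs]) hlt
  have hd : (x₂ - x₁) * C < 1 := by
    have := Int.abs_sub_lt_one_of_floor_eq_floor hfl
    rw [abs_lt] at this
    linarith
  refine hcon X Y ?_ h
  have hd0 : 0 < x₂ - x₁ := sub_pos.2 hlt
  nlinarith

theorem exists_point_between {a b : ℚ} (ha : 0 < a) (hab : a < b)
    (hga : 0 ≤ a ^ 2 + 5 * a - 32) :
    ∃ x y : ℚ, a < x ∧ x < b ∧ y ^ 2 = x ^ 3 + 5 * x ^ 2 - 32 * x := by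
  by_contra! hcon
  have hba : 0 < (b - a) ^ 2 := pow_pos (sub_pos.2 hab) 2
  have hb : 0 < b := ha.trans hab
  obtain ⟨X, Y, hX, hY, H⟩ := exists_point_gt
    (max b (max ((12 * a + 6 + a ^ 3 + 5 * a ^ 2) * b ^ 2 / (b - a) ^ 2)
      (a + 32 * a / (b - a) ^ 2)))
  rw [max_lt_iff, max_lt_iff, div_lt_iff₀ hba, ← lt_sub_iff_add_lt', div_lt_iff₀' hba] at hX
  obtain ⟨hbX, hX₁, hX₂⟩ := hX
  have hX0 : 0 < X := hb.trans hbX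
  have hfb : 0 < b ^ 3 + 5 * b ^ 2 - 32 * b := by
    have : 0 < b * (b ^ 2 + 5 * b - 32) := mul_pos hb (by nlinarith)
    linarith
  obtain ⟨δ, hδ0, hδ1, hδ⟩ : ∃ δ : ℚ, 0 < δ ∧ δ ≤ 1 ∧
      δ * (3 * X + 5) ≤ b ^ 3 + 5 * b ^ 2 - 32 * b := by
    refine ⟨min 1 ((b ^ 3 + 5 * b ^ 2 - 32 * b) / (3 * X + 5)), ?_, min_le_left _ _, ?_⟩
    · rw [lt_min_iff]; exact ⟨one_pos, by positivity⟩
    · rw [← le_div_iff₀ (by positivity)]; exact min_le_right _ _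
  have descent (n : ℕ) : ∃ x y : ℚ, b ≤ x ∧ x ≤ X - n * δ ∧ 0 < y ∧
      y ^ 2 = x ^ 3 + 5 * x ^ 2 - 32 * x := by
    induction n with
    | zero => exact ⟨X, Y, hbX.le, by simp, hY, H⟩
    | succ n ih =>
      obtain ⟨x, y, hbx, hxn, hy, h⟩ := ih
      obtain ⟨x', y', h', hax', hlt | ⟨hbx', hx'x, hy', hstep⟩⟩ :=
        exists_step ha hab hga hX₁ hX₂ hbx hy hY hX0 h H
      · exact (hcon x' y' hax' hlt h').elim
      refine ⟨x', y', hbx', ?_, hy', h'⟩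
      have hxX : x ≤ X := by
        have : 0 ≤ n * δ := by positivity
        linarith
      suffices δ ≤ x - x' by push_cast; linarith
      by_contra! hlt
      have h1 : (x - x') ^ 2 < δ := by nlinarith
      have h2 : (X + 5 + x + x') * (x - x') ^ 2 ≤ (3 * X + 5) * (x - x') ^ 2 := by
        apply mul_le_mul_of_nonneg_right _ (sq_nonneg _)
        linarith
      have h3 : (3 * X + 5) * (x - x') ^ 2 < (3 * X + 5) * δ := by gcongr
      have h4 : b ^ 3 + 5 * b ^ 2 - 32 * b ≤ x ^ 3 + 5 * x ^ 2 - 32 * x := by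
        have : 0 ≤ (x - b) * (x ^ 2 + x * b + b ^ 2 + 5 * (x + b) - 32) :=
          mul_nonneg (by linarith) (by nlinarith)
        linarith
      linarith
  obtain ⟨n, hn⟩ := exists_nat_gt (X / δ)
  rw [div_lt_iff₀ hδ0] at hn
  obtain ⟨x, y, hbx, hxn, -, -⟩ := descent n
  linarith

theorem mem_closure_abscissae {x : ℝ} (hx : 0 < x) (hg : 0 ≤ x ^ 2 + 5 * x - 32) :
    x ∈ closure {t : ℝ | 0 < t ∧ ∃ q r : ℚ, t = q ∧ r ^ 2 = q ^ 3 + 5 * q ^ 2 - 32 * q} := by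
  rw [Metric.mem_closure_iff]
  intro ε hε
  obtain ⟨a, hxa, haε⟩ := exists_rat_btwn (lt_add_of_pos_right x hε)
  obtain ⟨b, hab, hbε⟩ := exists_rat_btwn haε
  have ha : (0 : ℝ) < a := hx.trans hxa
  have hga : (0 : ℝ) ≤ a ^ 2 + 5 * a - 32 := by nlinarith
  obtain ⟨q, r, haq, hqb, h⟩ := exists_point_between (a := a) (b := b) (by exact_mod_cast ha)
    (by exact_mod_cast hab) (by exact_mod_cast hga)
  have haq' : (a : ℝ) < q := by exact_mod_cast haq
  have hqb' : (q : ℝ) < b := by exact_mod_cast hqb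
  refine ⟨q, ⟨ha.trans haq', q, r, rfl, h⟩, ?_⟩
  rw [Real.dist_eq, abs_lt]
  constructor <;> linarith

/-- Rational points are dense on the real locus of the curve `y² = x³ + 5x² − 32x`: the
Euclidean closure of the set of rational points of the curve is its full set of real
points. -/
theorem rational_points_dense :
    closure {P : ℝ × ℝ | (∃ x : ℚ, P.1 = x) ∧ (∃ y : ℚ, P.2 = y) ∧
        P.2 ^ 2 = P.1 ^ 3 + 5 * P.1 ^ 2 - 32 * P.1} =
      {P : ℝ × ℝ | P.2 ^ 2 = P.1 ^ 3 + 5 * P.1 ^ 2 - 32 * P.1} := by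
  apply Set.Subset.antisymm
  · exact closure_minimal (fun P hP => hP.2.2) (isClosed_eq (by fun_prop) (by fun_prop))
  rintro ⟨x, y⟩ h
  simp only [Set.mem_ofPred_eq] at h
  have hsqrt {t : ℝ} {q r : ℚ} (ht : t = q) (hr : r ^ 2 = q ^ 3 + 5 * q ^ 2 - 32 * q) :
      √(t ^ 3 + 5 * t ^ 2 - 32 * t) = ((|r| : ℚ) : ℝ) := by
    have : t ^ 3 + 5 * t ^ 2 - 32 * t = (r : ℝ) ^ 2 := by rw [ht]; exact_mod_cast hr.symm
    rw [this, Real.sqrt_sq_eq_abs, Rat.cast_abs]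
  obtain ⟨ε, hε, hy⟩ : ∃ ε : ℚ, ε ^ 2 = 1 ∧ y = ε * √(x ^ 3 + 5 * x ^ 2 - 32 * x) := by
    rw [← h, Real.sqrt_sq_eq_abs]
    rcases abs_choice y with hy | hy
    · exact ⟨1, by norm_num, by simp [hy]⟩
    · exact ⟨-1, by norm_num, by simp [hy]⟩
  rcases lt_trichotomy x 0 with hx | rfl | hx
  · obtain ⟨u, hu⟩ : ∃ u, u = -32 / x := ⟨_, rfl⟩
    have hu0 : 0 < u := hu ▸ div_pos_of_neg_of_neg (by norm_num) hx
    have hxu : x = -32 / u := by rw [hu]; field_simp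
    have hfx : (x ^ 3 + 5 * x ^ 2 - 32 * x) = (32 / u ^ 2) ^ 2 * (u ^ 3 + 5 * u ^ 2 - 32 * u) := by
      rw [hxu]; field_simp; ring
    have hgu : 0 ≤ u ^ 2 + 5 * u - 32 := by
      have h0 : 0 ≤ ((32 / u ^ 2) ^ 2 * u) * (u ^ 2 + 5 * u - 32) := by
        nlinarith [sq_nonneg y]
      exact nonneg_of_mul_nonneg_right h0 (by positivity)
    have hcont : ContinuousAt (fun t : ℝ =>
        (-32 / t, ε * (32 / t ^ 2 * √(t ^ 3 + 5 * t ^ 2 - 32 * t)))) u := by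
      have := hu0.ne'
      have := pow_ne_zero 2 hu0.ne'
      fun_prop (disch := assumption)
    have hmem := mem_closure_image hcont (mem_closure_abscissae hu0 hgu)
    have hP : (x, y) = (-32 / u, ε * (32 / u ^ 2 * √(u ^ 3 + 5 * u ^ 2 - 32 * u))) := by
      rw [← hxu, hy, hfx, Real.sqrt_mul (sq_nonneg _), Real.sqrt_sq (by positivity)]
    rw [hP]
    refine closure_mono ?_ hmem
    rintro _ ⟨t, ⟨ht, q, r, hq, hr⟩, rfl⟩
    have hq0 : q ≠ 0 := by rintro rfl; simp [hq] at ht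
    refine ⟨⟨-32 / q, by simp [hq]⟩, ⟨ε * (32 / q ^ 2 * |r|), ?_⟩, ?_⟩ <;> dsimp only <;>
      rw [hsqrt hq hr]
    · rw [hq]; push_cast; rfl
    · have : (ε * (32 / q ^ 2 * |r|)) ^ 2 =
          (-32 / q) ^ 3 + 5 * (-32 / q) ^ 2 - 32 * (-32 / q) := by
        rw [mul_pow, mul_pow, sq_abs, hε, hr]; field_simp; ring
      rw [hq]; exact_mod_cast this
  · have hy0 : y = 0 := by simpa using h
    exact subset_closure ⟨⟨0, by simp⟩, ⟨0, by simp [hy0]⟩, h⟩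
  · have hg : 0 ≤ x ^ 2 + 5 * x - 32 :=
      nonneg_of_mul_nonneg_right (a := x) (by nlinarith [sq_nonneg y]) hx
    have hcont : ContinuousAt (fun t : ℝ => (t, ε * √(t ^ 3 + 5 * t ^ 2 - 32 * t))) x := by
      fun_prop
    have hmem := mem_closure_image hcont (mem_closure_abscissae hx hg)
    rw [hy]
    refine closure_mono ?_ hmem
    rintro _ ⟨t, ⟨-, q, r, hq, hr⟩, rfl⟩
    refine ⟨⟨q, hq⟩, ⟨ε * |r|, ?_⟩, ?_⟩ <;> dsimp only <;> rw [hsqrt hq hr]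
    · push_cast; rfl
    · have : (ε * |r|) ^ 2 = q ^ 3 + 5 * q ^ 2 - 32 * q := by
        rw [mul_pow, sq_abs, hε, hr, one_mul]
      rw [hq]; exact_mod_cast this
end

section
/- The triangle inscribed in the regular heptagon with side lengths 2·sin(π/7), 2·sin(2π/7), 2·sin(4π/7) is a Sharygin triangle: these three lengths are pairwise distinct, satisfy the triangle inequalities, and satisfy q(2·sin(π/7), 2·sin(2π/7), 2·sin(4π/7)) = 0. -/
open Real

/-- `2 cos(π/7)` is a root of `u³ - u² - 2u + 1`. -/
theorem two_cos_pi_div_seven_cubic :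
    (2 * cos (π / 7)) ^ 3 - (2 * cos (π / 7)) ^ 2 - 2 * (2 * cos (π / 7)) + 1 = 0 := by
  have h : cos (4 * (π / 7)) = -cos (3 * (π / 7)) := by
    rw [← cos_pi_sub]
    congr 1
    ring
  rw [show 4 * (π / 7) = 2 * (2 * (π / 7)) by ring, cos_two_mul, cos_two_mul,
    cos_three_mul] at h
  have hpos : 0 < cos (π / 7) := cos_pos_of_mem_Ioo ⟨by linarith [pi_pos], by linarith [pi_pos]⟩
  have hne : cos (π / 7) + 1 ≠ 0 := by positivity
  apply mul_left_cancel₀ hne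
  linear_combination h

theorem sin_four_pi_div_seven :
    sin (4 * π / 7) = sin (π / 7) * ((2 * cos (π / 7)) ^ 2 - 1) := by
  rw [show 4 * π / 7 = π - 3 * (π / 7) by ring, sin_pi_sub, sin_three_mul]
  linear_combination -4 * sin (π / 7) * sin_sq_add_cos_sq (π / 7)

/-- The triangle inscribed in the regular heptagon, with side lengths `2 sin(π/7)`,
`2 sin(2π/7)`, `2 sin(4π/7)`, is a Sharygin triangle: its side lengths are pairwise
distinct, satisfy the triangle inequalities, and satisfy `q(a,b,c) = 0`. -/
theorem heptagon_sharygin_triangle :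
    2 * sin (π / 7) ≠ 2 * sin (2 * π / 7) ∧
    2 * sin (π / 7) ≠ 2 * sin (4 * π / 7) ∧
    2 * sin (2 * π / 7) ≠ 2 * sin (4 * π / 7) ∧
    2 * sin (π / 7) < 2 * sin (2 * π / 7) + 2 * sin (4 * π / 7) ∧
    2 * sin (2 * π / 7) < 2 * sin (π / 7) + 2 * sin (4 * π / 7) ∧
    2 * sin (4 * π / 7) < 2 * sin (π / 7) + 2 * sin (2 * π / 7) ∧
    q (2 * sin (π / 7)) (2 * sin (2 * π / 7)) (2 * sin (4 * π / 7)) = 0 := by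
  have hs : 0 < sin (π / 7) := sin_pos_of_pos_of_lt_pi (by positivity) (by linarith [pi_pos])
  have h1 : 1 < 2 * cos (π / 7) := by
    have := cos_lt_cos_of_nonneg_of_le_pi (x := π / 7) (y := π / 3) (by positivity)
      (by linarith [pi_pos]) (by linarith [pi_pos])
    rw [cos_pi_div_three] at this
    linarith
  have h2 : 2 * cos (π / 7) < 2 := by
    have := cos_lt_cos_of_nonneg_of_le_pi (x := 0) (y := π / 7) le_rfl
      (by linarith [pi_pos]) (by positivity)
    rw [cos_zero] at this
    linarith
  have hu := two_cos_pi_div_seven_cubic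
  have hb : sin (2 * π / 7) = sin (π / 7) * (2 * cos (π / 7)) := by
    rw [show 2 * π / 7 = 2 * (π / 7) by ring, sin_two_mul]
    ring
  rw [hb, sin_four_pi_div_seven]
  generalize 2 * cos (π / 7) = u at *
  generalize sin (π / 7) = s at *
  refine ⟨fun h => ?_, fun h => ?_, fun h => ?_, ?_, ?_, ?_, ?_⟩
  · have : u = 1 := mul_left_cancel₀ hs.ne' (by linarith)
    linarith
  · have : u ^ 2 = 2 := by
      have : u ^ 2 - 1 = 1 := mul_left_cancel₀ hs.ne' (by linarith)
      linarith
    have : (0 : ℝ) = 1 := by linear_combination hu - (u - 1) * this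
    norm_num at this
  · have : u = u ^ 2 - 1 := mul_left_cancel₀ hs.ne' (by linarith)
    have : u = 1 := by linear_combination -hu - u * this
    linarith
  · nlinarith [mul_pos hs (show 0 < u + (u ^ 2 - 1) - 1 by nlinarith)]
  · nlinarith [mul_pos hs (show 0 < 1 + (u ^ 2 - 1) - u by nlinarith)]
  · nlinarith [mul_pos hs (show 0 < 1 + u - (u ^ 2 - 1) by nlinarith)]
  · unfold q
    linear_combination -(2 * s) ^ 3 * (u ^ 3 + 2 * u ^ 2 + u) * hu
end

section
/- For all real numbers α and β, the identity q(sin α, sin β, sin(α+β)) = sin α · sin β · (sin α + sin β + sin(α+β) − sin(2α+β) − sin(α+2β) − sin(2α+2β)) holds. Consequently, for a triangle with angles α, β, γ = π − α − β and side lengths proportional to sin α, sin β, sin γ, the condition q(a,b,c) = 0 is equivalent to sin α + sin β + sin(α+β) = sin(α+2β) + sin(2α+β) + sin(2α+2β). -/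
open Real

/-- The law of cosines for the angles `α`, `β`, `π - α - β`, written with sines as side lengths. -/
theorem sin_sq_add_sin_sq_sub_sin_add_sq (α β : ℝ) :
    sin α ^ 2 + sin β ^ 2 - sin (α + β) ^ 2 = -2 * sin α * sin β * cos (α + β) := by
  rw [sin_add, cos_add]
  linear_combination (-sin α ^ 2) * sin_sq_add_cos_sq β - sin β ^ 2 * sin_sq_add_cos_sq α

theorem q_eq_mul_sq_add_sq_sub_sq_add (a b c : ℝ) :
    q a b c = (a + b + c) * (a ^ 2 + b ^ 2 - c ^ 2) + a * b * c := by
  unfold q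
  ring

/-- The value of the Sharygin cubic at `sin α`, `sin β`, `sin (α + β)`. -/
theorem q_sin_sin_sin_add (α β : ℝ) :
    q (sin α) (sin β) (sin (α + β)) =
      sin α * sin β * (sin α + sin β + sin (α + β) - sin (2 * α + β) - sin (α + 2 * β) -
        sin (2 * α + 2 * β)) := by
  have hα := two_mul_sin_mul_cos α (α + β)
  have hβ := two_mul_sin_mul_cos β (α + β)
  have hγ := sin_two_mul (α + β)
  rw [show α + (α + β) = 2 * α + β by ring, show α - (α + β) = -β by ring, sin_neg] at hα
  rw [show β + (α + β) = α + 2 * β by ring, show β - (α + β) = -α by ring, sin_neg] at hβ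
  rw [mul_add] at hγ
  rw [q_eq_mul_sq_add_sq_sub_sq_add, sin_sq_add_sin_sq_sub_sin_add_sq]
  linear_combination sin α * sin β * (hγ - hα - hβ)

/-- The identity
`q(sin α, sin β, sin(α+β)) = sin α · sin β · (sin α + sin β + sin(α+β) − sin(2α+β) −
sin(α+2β) − sin(2α+2β))` holds for all real `α`, `β`; consequently, for a triangle with
angles `α`, `β`, `π − α − β`, the condition `q = 0` on its side lengths is equivalent to
`sin α + sin β + sin(α+β) = sin(α+2β) + sin(2α+β) + sin(2α+2β)`. -/
theorem q_sin_identity (α β : ℝ) :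
    q (sin α) (sin β) (sin (α + β)) =
      sin α * sin β * (sin α + sin β + sin (α + β) - sin (2 * α + β) - sin (α + 2 * β) -
        sin (2 * α + 2 * β)) ∧
    (0 < α → 0 < β → α + β < π →
      (q (sin α) (sin β) (sin (α + β)) = 0 ↔
        sin α + sin β + sin (α + β) =
          sin (α + 2 * β) + sin (2 * α + β) + sin (2 * α + 2 * β))) := by
  refine ⟨q_sin_sin_sin_add α β, fun hα hβ hαβ => ?_⟩
  have hsα : sin α ≠ 0 := (sin_pos_of_pos_of_lt_pi hα (by linarith)).ne'
  have hsβ : sin β ≠ 0 := (sin_pos_of_pos_of_lt_pi hβ (by linarith)).ne'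
  rw [q_sin_sin_sin_add, mul_eq_zero, or_iff_right (mul_ne_zero hsα hsβ)]
  constructor <;> intro h <;> linarith
end

section
/- The polynomial 2·X⁴ − 21·X² + 2 is irreducible over ℚ and has the real number B = √((5 − √17)/(5 + √17)) as a root; consequently [ℚ(B) : ℚ] = 4 and B does not lie in the quadratic field ℚ(√17), i.e., B cannot be written as r + s·√17 with r, s ∈ ℚ. -/
open Polynomial Real IntermediateField

theorem Polynomial.monic_biquadratic {R : Type*} [CommRing R] [Nontrivial R] (a b : R) :
    (X ^ 4 + C a * X ^ 2 + C b : R[X]).Monic := by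
  monicity!

theorem Polynomial.natDegree_biquadratic {R : Type*} [CommRing R] [Nontrivial R] (a b : R) :
    (X ^ 4 + C a * X ^ 2 + C b : R[X]).natDegree = 4 := by
  compute_degree!

/-- The biquadratic `X⁴ + aX² + b²` over a domain is irreducible as soon as none of
`a² - 4b²`, `2b - a`, `-2b - a` is a square. -/
theorem Polynomial.irreducible_biquadratic {R : Type*} [CommRing R] [IsDomain R] {a b : R}
    (hdisc : ¬IsSquare (a ^ 2 - 4 * b ^ 2)) (hpos : ¬IsSquare (2 * b - a))
    (hneg : ¬IsSquare (-2 * b - a)) :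
    Irreducible (X ^ 4 + C a * X ^ 2 + C (b ^ 2) : R[X]) := by
  have hmonic := monic_biquadratic a (b ^ 2)
  have hdeg := natDegree_biquadratic a (b ^ 2)
  have hne : (X ^ 4 + C a * X ^ 2 + C (b ^ 2) : R[X]) ≠ 1 := by
    intro h
    rw [h, natDegree_one] at hdeg
    omega
  refine hmonic.irreducible_iff_natDegree'.mpr ⟨hne, fun f g hf hg hfg hmem => ?_⟩
  rw [hdeg, Finset.mem_Ioc] at hmem
  have hadd : f.natDegree + g.natDegree = 4 := by
    rw [← hf.natDegree_mul hg, hfg, hdeg]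
  obtain hg1 | hg2 : g.natDegree = 1 ∨ g.natDegree = 2 := by omega
  · have hgX := hg.eq_X_add_C hg1
    have hroot := congrArg (eval (-g.coeff 0)) hfg
    rw [eval_mul, hgX] at hroot
    simp only [eval_add, eval_mul, eval_pow, eval_X, eval_C, coeff_add, coeff_X_zero,
      coeff_C_zero, zero_add, neg_add_cancel, mul_zero] at hroot
    exact hdisc ⟨2 * g.coeff 0 ^ 2 + a, by linear_combination 4 * hroot⟩
  · have hf2 : f.natDegree = 2 := by omega
    have hfX : f = X ^ 2 + C (f.coeff 1) * X + C (f.coeff 0) := by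
      conv_lhs => rw [hf.as_sum, hf2]
      simp [Finset.sum_range_succ]
      ring
    have hgX : g = X ^ 2 + C (g.coeff 1) * X + C (g.coeff 0) := by
      conv_lhs => rw [hg.as_sum, hg2]
      simp [Finset.sum_range_succ]
      ring
    generalize f.coeff 1 = p at hfX
    generalize f.coeff 0 = q at hfX
    generalize g.coeff 1 = r at hgX
    generalize g.coeff 0 = s at hgX
    have hprod : X ^ 4 + C (p + r) * X ^ 3 + C (q + s + p * r) * X ^ 2 + C (p * s + q * r) * X
        + C (q * s) = (X ^ 4 + C a * X ^ 2 + C (b ^ 2) : R[X]) := by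
      rw [← hfg, hfX, hgX]
      simp only [C_add, C_mul]
      ring
    have h3 : p + r = 0 := by
      simpa [coeff_X, coeff_C, -map_add, -map_mul, -map_pow] using congrArg (coeff · 3) hprod
    have h2 : q + s + p * r = a := by
      simpa [coeff_X, coeff_C, -map_add, -map_mul, -map_pow] using congrArg (coeff · 2) hprod
    have h1 : p * s + q * r = 0 := by
      simpa [coeff_X, coeff_C, -map_add, -map_mul, -map_pow] using congrArg (coeff · 1) hprod
    have h0 : q * s = b ^ 2 := by
      simpa [coeff_X, coeff_C, -map_add, -map_mul, -map_pow] using congrArg (coeff · 0) hprod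
    obtain rfl : r = -p := by linear_combination h3
    have hps : p * (s - q) = 0 := by linear_combination h1
    obtain hp | hs := mul_eq_zero.mp hps
    · subst hp
      refine hdisc ⟨q - s, ?_⟩
      rw [← h2]
      linear_combination 4 * h0
    · obtain rfl : s = q := by linear_combination hs
      obtain rfl | rfl := sq_eq_sq_iff_eq_or_eq_neg.mp (show s ^ 2 = b ^ 2 by rw [← h0]; ring)
      · exact hpos ⟨p, by linear_combination h2⟩
      · exact hneg ⟨p, by linear_combination h2⟩

theorem Real.sqrt_ratio_biquadratic_root :
    √((5 - √17) / (5 + √17)) ^ 4 - 21 / 2 * √((5 - √17) / (5 + √17)) ^ 2 + 1 = 0 := by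
  have h17 : √17 ^ 2 = 17 := Real.sq_sqrt (by norm_num)
  have hle : √17 ≤ 5 := Real.sqrt_le_iff.mpr (by norm_num)
  have hpos : 0 < 5 + √17 := by positivity
  have hsq : √((5 - √17) / (5 + √17)) ^ 2 = (21 - 5 * √17) / 4 := by
    rw [Real.sq_sqrt (div_nonneg (by linarith) hpos.le), div_eq_iff hpos.ne']
    linear_combination 5 / 4 * h17
  rw [show √((5 - √17) / (5 + √17)) ^ 4 = (√((5 - √17) / (5 + √17)) ^ 2) ^ 2 by ring, hsq]
  linear_combination 25 / 16 * h17

/-- An element `r + s√d` of a quadratic extension has minimal polynomial of degree at most two. -/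
theorem minpoly.natDegree_le_two_of_eq_add_mul {K L : Type*} [Field K] [Field L] [Algebra K L]
    {x y : L} {d r s : K} (hy : y ^ 2 = algebraMap K L d)
    (hx : x = algebraMap K L r + algebraMap K L s * y) : (minpoly K x).natDegree ≤ 2 := by
  have hmonic : (X ^ 2 + C (-2 * r) * X + C (r ^ 2 - d * s ^ 2) : K[X]).Monic := by monicity!
  have hdeg : (X ^ 2 + C (-2 * r) * X + C (r ^ 2 - d * s ^ 2) : K[X]).natDegree = 2 := by
    compute_degree!
  rw [← hdeg]
  refine natDegree_le_natDegree (minpoly.min K x hmonic ?_)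
  simp only [map_add, map_mul, map_pow, map_sub, map_neg, map_ofNat, aeval_X, aeval_C, hx]
  linear_combination algebraMap K L s ^ 2 * hy

/-- The polynomial `2X⁴ − 21X² + 2` is irreducible over `ℚ` and has
`B = √((5 − √17)/(5 + √17))` as a root; consequently `[ℚ(B) : ℚ] = 4` and `B` does not lie
in the quadratic field `ℚ(√17)`. -/
theorem two_descent_quartic (B : ℝ)
    (hB : B = Real.sqrt ((5 - Real.sqrt 17) / (5 + Real.sqrt 17))) :
    Irreducible (C 2 * X ^ 4 - C 21 * X ^ 2 + C 2 : ℚ[X]) ∧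
    Polynomial.aeval B (C 2 * X ^ 4 - C 21 * X ^ 2 + C 2 : ℚ[X]) = 0 ∧
    Module.finrank ℚ ℚ⟮B⟯ = 4 ∧
    ¬∃ r s : ℚ, B = (r : ℝ) + (s : ℝ) * Real.sqrt 17 := by
  have hmonic := monic_biquadratic (-21 / 2 : ℚ) (1 ^ 2)
  have hirr : Irreducible (X ^ 4 + C (-21 / 2) * X ^ 2 + C (1 ^ 2) : ℚ[X]) := by
    apply irreducible_biquadratic <;> rw [Rat.isSquare_iff] <;> norm_num
  have hroot : aeval B (X ^ 4 + C (-21 / 2) * X ^ 2 + C (1 ^ 2) : ℚ[X]) = 0 := by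
    have h := Real.sqrt_ratio_biquadratic_root
    rw [← hB] at h
    simp only [map_add, map_mul, map_pow, aeval_X, aeval_C, eq_ratCast]
    push_cast
    linear_combination h
  have hfactor : (C 2 * X ^ 4 - C 21 * X ^ 2 + C 2 : ℚ[X]) =
      C 2 * (X ^ 4 + C (-21 / 2) * X ^ 2 + C (1 ^ 2)) := by
    have h21 : (C 21 : ℚ[X]) = -(C 2 * C (-21 / 2)) := by
      rw [← C_mul, ← C_neg]
      norm_num
    rw [h21, one_pow, C_1]
    ring
  have hdeg : (minpoly ℚ B).natDegree = 4 := by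
    rw [← minpoly.eq_of_irreducible_of_monic hirr hroot hmonic, natDegree_biquadratic]
  refine ⟨?_, ?_, ?_, ?_⟩
  · rw [hfactor]
    exact (irreducible_isUnit_mul (isUnit_C.mpr (by norm_num))).mpr hirr
  · rw [hfactor, map_mul, hroot, mul_zero]
  · rw [adjoin.finrank ⟨_, hmonic, hroot⟩, hdeg]
  · rintro ⟨r, s, h⟩
    have hle := minpoly.natDegree_le_two_of_eq_add_mul (K := ℚ) (d := 17)
      (by rw [Real.sq_sqrt (by norm_num)]; norm_num) h
    omega
end
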